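/- arXiv:1307.0992 — 2 statements merged into one kernel-verified Lean document; each statement's English description precedes it below -/
import Mathlib

section
/- Let G be a countable graph with an end ω of finite vertex-degree. If for every k ∈ ℕ there are k pairwise edge-disjoint double rays, both of whose constituent rays converge to ω, then G contains infinitely many pairwise edge-disjoint double rays. -/
open SimpleGraph

variable {V : Type*}

/-- A ray in `G`: an injective sequence of vertices with consecutive vertices adjacent. -/
def IsRay (G : SimpleGraph V) (f : ℕ → V) : Prop :=
  Function.Injective f ∧ ∀ n, G.Adj (f n) (f (n + 1))

/-- A double ray in `G`: an injective two-way infinite sequence with consecutive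
vertices adjacent. -/
def IsDoubleRay (G : SimpleGraph V) (f : ℤ → V) : Prop :=
  Function.Injective f ∧ ∀ n, G.Adj (f n) (f (n + 1))

/-- The edges used by a ray. -/
def rayEdges (f : ℕ → V) : Set (Sym2 V) := {e | ∃ n, e = s(f n, f (n + 1))}

/-- The edges used by a double ray. -/
def drEdges (f : ℤ → V) : Set (Sym2 V) := {e | ∃ n : ℤ, e = s(f n, f (n + 1))}

/-- Two rays are equivalent (belong to the same end) iff no finite vertex set
separates them: for every finite `S` there are tails of both rays avoiding `S`
which are joined by a walk avoiding `S`. -/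
def RayEquiv (G : SimpleGraph V) (f g : ℕ → V) : Prop :=
  ∀ S : Finset V, ∃ a b, (∀ i, a ≤ i → f i ∉ S) ∧ (∀ j, b ≤ j → g j ∉ S) ∧
    ∃ w : G.Walk (f a) (g b), ∀ v ∈ w.support, v ∉ S

/-- The forward ray of a double ray. -/
def drFwd (f : ℤ → V) : ℕ → V := fun n => f n

/-- The backward ray of a double ray. -/
def drBwd (f : ℤ → V) : ℕ → V := fun n => f (-(n : ℤ) - 1)

/-- The end (represented by the ray `R`) has vertex-degree exactly `k`:
there are `k` pairwise vertex-disjoint rays equivalent to `R`, but not `k + 1`. -/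
def EndVertexDegree (G : SimpleGraph V) (R : ℕ → V) (k : ℕ) : Prop :=
  (∃ F : Fin k → ℕ → V, (∀ i, IsRay G (F i) ∧ RayEquiv G R (F i)) ∧
      Pairwise fun i j => Disjoint (Set.range (F i)) (Set.range (F j))) ∧
  ¬ ∃ F : Fin (k + 1) → ℕ → V, (∀ i, IsRay G (F i) ∧ RayEquiv G R (F i)) ∧
      Pairwise fun i j => Disjoint (Set.range (F i)) (Set.range (F j))

/-- `a` and `b` are joined in `G` by a walk avoiding `S`. -/
def AvoidReach (G : SimpleGraph V) (S : Set V) (a b : V) : Prop :=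
  a ∉ S ∧ Relation.ReflTransGen (fun x y => G.Adj x y ∧ y ∉ S) a b

namespace AvoidReach

variable {G H : SimpleGraph V} {S S' : Set V} {a b c : V}

lemma refl (h : a ∉ S) : AvoidReach G S a a := ⟨h, .refl⟩

lemma step (h : AvoidReach G S a b) (hbc : G.Adj b c) (hc : c ∉ S) : AvoidReach G S a c :=
  ⟨h.1, h.2.tail ⟨hbc, hc⟩⟩

lemma right (h : AvoidReach G S a b) : b ∉ S := by
  obtain ⟨h1, h2⟩ := h
  induction h2 with
  | refl => exact h1
  | tail _ h _ => exact h.2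

lemma trans (h : AvoidReach G S a b) (h' : AvoidReach G S b c) : AvoidReach G S a c :=
  ⟨h.1, h.2.trans h'.2⟩

lemma head (hab : G.Adj a b) (ha : a ∉ S) (h : AvoidReach G S b c) : AvoidReach G S a c :=
  ⟨ha, .head ⟨hab, h.1⟩ h.2⟩

lemma symm (h : AvoidReach G S a b) : AvoidReach G S b a := by
  obtain ⟨h1, h2⟩ := h
  induction h2 with
  | refl => exact refl h1
  | @tail b c hb hbc ih => exact head hbc.1.symm hbc.2 ih

/-- A property holding at the start and preserved along edges outside `S` holds at the end. -/
lemma induct (h : AvoidReach G S a b) {P : V → Prop} (ha : P a)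
    (hs : ∀ x y, AvoidReach G S a x → P x → G.Adj x y → y ∉ S → P y) : P b := by
  obtain ⟨h1, h2⟩ := h
  induction h2 with
  | refl => exact ha
  | tail hb hbc ih => exact hs _ _ ⟨h1, hb⟩ ih hbc.1 hbc.2

lemma mono (h : AvoidReach G S a b) (hG : G ≤ H) (hS : S' ⊆ S) : AvoidReach H S' a b :=
  ⟨fun h1 => h.1 (hS h1), Relation.ReflTransGen.lift id
    (fun _ _ h => ⟨hG h.1, fun h1 => h.2 (hS h1)⟩) _ _ h.2⟩

lemma of_walk (w : G.Walk a b) (hw : ∀ x ∈ w.support, x ∉ S) : AvoidReach G S a b := by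
  induction w with
  | nil => exact refl (hw _ (by simp))
  | cons h p ih =>
    exact head h (hw _ (by simp)) (ih fun x hx => hw x (by simp [hx]))

lemma exists_walk (h : AvoidReach G S a b) :
    ∃ w : G.Walk a b, ∀ x ∈ w.support, x ∉ S := by
  obtain ⟨h1, h2⟩ := h
  induction h2 with
  | refl => exact ⟨.nil, by simpa using h1⟩
  | tail hb hbc ih =>
    obtain ⟨w, hw⟩ := ih
    refine ⟨w.concat hbc.1, fun x hx => ?_⟩
    rw [Walk.support_concat, List.mem_append] at hx
    rcases hx with hx | hx
    · exact hw x hx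
    · simp only [List.mem_singleton] at hx
      exact hx ▸ hbc.2

end AvoidReach

/-- The set `S` meets every walk from `A` to `B`. -/
def Separates (G : SimpleGraph V) (A B S : Set V) : Prop :=
  ∀ a ∈ A, ∀ b ∈ B, ¬ AvoidReach G S a b

/-- There are `n` pairwise disjoint paths from `A` to `B`. -/
def Linked (G : SimpleGraph V) (A B : Set V) (n : ℕ) : Prop :=
  ∃ (a b : Fin n → V) (p : ∀ i, G.Walk (a i) (b i)), (∀ i, a i ∈ A) ∧ (∀ i, b i ∈ B) ∧
    (∀ i, (p i).IsPath) ∧ ∀ i j, i ≠ j → ∀ x ∈ (p i).support, x ∉ (p j).support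

lemma Linked.mono {G H : SimpleGraph V} {A B : Set V} {n : ℕ} (h : Linked G A B n) (hG : G ≤ H) :
    Linked H A B n := by
  obtain ⟨a, b, p, ha, hb, hp, hd⟩ := h
  refine ⟨a, b, fun i => (p i).mapLe hG, ha, hb, fun i => (Walk.isPath_mapLe hG).2 (hp i), ?_⟩
  intro i j hij x hx
  rw [Walk.support_mapLe_eq_support] at hx ⊢
  exact hd i j hij x hx

/-- The initial segment of a walk up to the first vertex satisfying `Q`, made into a path. -/
lemma exists_path_to_first {G : SimpleGraph V} {a b : V} (w : G.Walk a b) (Q : Set V)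
    (hb : b ∈ Q) : ∃ (c : V) (p : G.Walk a c), p.IsPath ∧ c ∈ Q ∧ p.support ⊆ w.support ∧
      ∀ x ∈ p.support, x ∈ Q → x = c := by
  classical
  suffices h : ∃ (c : V) (p : G.Walk a c), c ∈ Q ∧ p.support ⊆ w.support ∧
      ∀ x ∈ p.support, x ∈ Q → x = c by
    obtain ⟨c, p, h1, h2, h3⟩ := h
    exact ⟨c, p.bypass, p.bypass_isPath, h1, fun x hx => h2 (p.support_bypass_subset_support hx),
      fun x hx => h3 x (p.support_bypass_subset_support hx)⟩
  induction w with
  | nil => exact ⟨_, .nil, hb, by simp, by simp⟩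
  | @cons u v w h p ih =>
    by_cases hu : u ∈ Q
    · exact ⟨u, .nil, hu, by simp, by simp⟩
    · obtain ⟨c, q, h1, h2, h3⟩ := ih hb
      refine ⟨c, .cons h q, h1, ?_, ?_⟩
      · intro x hx
        simp only [Walk.support_cons, List.mem_cons] at hx ⊢
        exact hx.imp_right fun hx => h2 hx
      · intro x hx hxQ
        simp only [Walk.support_cons, List.mem_cons] at hx
        rcases hx with rfl | hx
        · exact absurd hxQ hu
        · exact h3 x hx hxQ

lemma Walk.IsPath.eq_end_of_mem_takeUntil [DecidableEq V] {G : SimpleGraph V} {a b v : V}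
    {p : G.Walk a b} (hp : p.IsPath) (hv : v ∈ p.support)
    (h : b ∈ (p.takeUntil v hv).support) : v = b := by
  by_contra hne
  exact Walk.endpoint_notMem_support_takeUntil hp hv (Ne.symm hne) h

lemma Walk.IsPath.eq_start_of_mem_dropUntil [DecidableEq V] {G : SimpleGraph V} {a b v : V}
    {p : G.Walk a b} (hp : p.IsPath) (hv : v ∈ p.support)
    (h : a ∈ (p.dropUntil v hv).support) : v = a := by
  by_contra hne
  have h1 := hp.support_nodup
  rw [← p.take_spec hv, Walk.support_append] at h1
  rw [← Walk.cons_tail_support, List.mem_cons] at h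
  exact List.disjoint_of_nodup_append h1 (Walk.start_mem_support _)
    (h.resolve_left (Ne.symm hne))

open scoped Classical in
lemma menger_glue {G G' : SimpleGraph V} {A B : Set V} {S : Finset V} {x y : V} (hle : G' ≤ G)
    (hxy : G.Adj x y) (hx : x ∉ S) (hy : y ∉ S) (hS : Separates G' A B S)
    (h1 : Linked G' A (insert x S : Finset V) (S.card + 1))
    (h2 : Linked G' (insert y S : Finset V) B (S.card + 1)) : Linked G A B (S.card + 1) := by
  obtain ⟨a, b, p, ha, hb, hp, hpd⟩ := h1
  obtain ⟨a', b', q, ha', hb', hq, hqd⟩ := h2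
  have hbi : Function.Injective b := fun i j hij => by
    by_contra hne
    exact hpd i j hne (b i) (by simp) (by simp [hij])
  have hai : Function.Injective a' := fun i j hij => by
    by_contra hne
    exact hqd i j hne (a' i) (by simp) (by simp [hij])
  have hsurj : ∀ {z : V} {f : Fin (S.card + 1) → V}, z ∉ S → Function.Injective f →
      (∀ i, f i ∈ (insert z S : Finset V)) → ∀ v ∈ insert z S, ∃ i, f i = v := by
    intro z f hz hf hm v hv
    have := Finset.eq_of_subset_of_card_le (s := Finset.univ.image f) (t := insert z S)
      (by intro v; simpa using fun i hi => by simpa [← hi] using hm i)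
      (by rw [Finset.card_image_of_injective _ hf, Finset.card_insert_of_notMem hz]; simp)
    rw [← this] at hv
    simpa using hv
  have hbs := hsurj hx hbi hb
  have has := hsurj hy hai ha'
  have hbu : ∀ i, ∀ v ∈ (p i).support, v ∈ insert x S → v = b i := by
    intro i v hv hvS
    obtain ⟨j, rfl⟩ := hbs v hvS
    by_contra hne
    exact hpd i j (fun h => hne (by rw [h])) _ hv (by simp)
  have hau : ∀ i, ∀ v ∈ (q i).support, v ∈ insert y S → v = a' i := by
    intro i v hv hvS
    obtain ⟨j, rfl⟩ := has v hvS
    by_contra hne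
    exact hqd i j (fun h => hne (by rw [h])) _ hv (by simp)
  have hmeet : ∀ i j v, v ∈ (p i).support → v ∈ (q j).support → v ∈ S ∧ v = b i ∧ v = a' j := by
    intro i j v hvp hvq
    have hvS : v ∈ S := by
      by_contra hvS
      have h1 : AvoidReach G' (S : Set V) (a i) v := by
        refine AvoidReach.of_walk ((p i).takeUntil v hvp) fun s hs hsS => hvS ?_
        have h3 := hbu i s ((p i).support_takeUntil_subset_support hvp hs)
          (Finset.mem_insert_of_mem hsS)
        subst h3
        rw [Walk.IsPath.eq_end_of_mem_takeUntil (hp i) hvp hs]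
        exact hsS
      have h2 : AvoidReach G' (S : Set V) v (b' j) := by
        refine AvoidReach.of_walk ((q j).dropUntil v hvq) fun s hs hsS => hvS ?_
        have h3 := hau j s ((q j).support_dropUntil_subset_support hvq hs)
          (Finset.mem_insert_of_mem hsS)
        subst h3
        rw [Walk.IsPath.eq_start_of_mem_dropUntil (hq j) hvq hs]
        exact hsS
      exact hS _ (ha i) _ (hb' j) (h1.trans h2)
    exact ⟨hvS, hbu i v hvp (Finset.mem_insert_of_mem hvS),
      hau j v hvq (Finset.mem_insert_of_mem hvS)⟩
  have hφ : ∀ i, ∃ j, (b i ∈ S ∧ a' j = b i) ∨ (b i = x ∧ a' j = y) := by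
    intro i
    have := hb i
    simp only [Finset.coe_insert, Set.mem_insert_iff, Finset.mem_coe] at this
    rcases this with h | h
    · obtain ⟨j, hj⟩ := has y (Finset.mem_insert_self _ _)
      exact ⟨j, .inr ⟨h, hj⟩⟩
    · obtain ⟨j, hj⟩ := has _ (Finset.mem_insert_of_mem h)
      exact ⟨j, .inl ⟨h, hj⟩⟩
  choose φ hφ using hφ
  have hφi : Function.Injective φ := by
    intro i j hij
    have h1 := hφ i
    have h2 := hφ j
    rw [hij] at h1
    apply hbi
    rcases h1 with h1 | h1 <;> rcases h2 with h2 | h2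
    · rw [← h1.2, h2.2]
    · exact absurd h1.1 (by rw [← h1.2, h2.2]; exact hy)
    · exact absurd h2.1 (by rw [← h2.2, h1.2]; exact hy)
    · rw [h1.1, h2.1]
  have hw : ∀ i, ∃ w : G.Walk (a i) (b' (φ i)), w.IsPath ∧
      ∀ v ∈ w.support, v ∈ (p i).support ∨ v ∈ (q (φ i)).support := by
    intro i
    have : ∃ w : G.Walk (a i) (b' (φ i)),
        ∀ v ∈ w.support, v ∈ (p i).support ∨ v ∈ (q (φ i)).support := by
      have hadj : b i = a' (φ i) ∨ G.Adj (b i) (a' (φ i)) := by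
        rcases hφ i with h | h
        · exact .inl h.2.symm
        · exact .inr (by rw [h.1, h.2]; exact hxy)
      rcases hadj with h | h
      · refine ⟨((p i).mapLe hle).append (((q (φ i)).mapLe hle).copy h.symm rfl), ?_⟩
        intro v hv
        simpa [Walk.mem_support_append_iff] using hv
      · refine ⟨((p i).mapLe hle).append (.cons h ((q (φ i)).mapLe hle)), ?_⟩
        intro v hv
        simp only [Walk.mem_support_append_iff, Walk.support_cons, List.mem_cons,
          Walk.support_mapLe_eq_support] at hv
        rcases hv with hv | rfl | hv
        · exact .inl hv
        · exact .inl (by simp)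
        · exact .inr hv
    obtain ⟨w, hw⟩ := this
    exact ⟨w.bypass, w.bypass_isPath, fun v hv => hw v (w.support_bypass_subset_support hv)⟩
  choose w hwp hw using hw
  refine ⟨a, fun i => b' (φ i), w, ha, fun i => hb' _, hwp, ?_⟩
  have hcross : ∀ i j, i ≠ j → ∀ v, v ∈ (p i).support → v ∉ (q (φ j)).support := by
    intro i j hij v h1 h2
    obtain ⟨h3, h4, h5⟩ := hmeet _ _ _ h1 h2
    rcases hφ i with h | h
    · exact hij (hφi (hai (by rw [h.2, ← h4, h5])))
    · exact hx (by rw [← h.1, ← h4]; exact h3)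
  intro i j hij v hvi hvj
  rcases hw i v hvi with h1 | h1 <;> rcases hw j v hvj with h2 | h2
  · exact hpd i j hij v h1 h2
  · exact hcross i j hij v h1 h2
  · exact hcross j i hij.symm v h2 h1
  · exact hqd _ _ (hφi.ne hij) v h1 h2

open scoped Classical in
lemma menger_step {G G' : SimpleGraph V} {n : ℕ} {x₀ y₀ : V} (hle : G' ≤ G)
    (hG : ∀ u v, G.Adj u v → G'.Adj u v ∨ (u = x₀ ∧ v = y₀) ∨ (u = y₀ ∧ v = x₀))
    (ih : ∀ A B : Set V, (∀ S : Finset V, Separates G' A B S → n ≤ S.card) → Linked G' A B n)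
    {A B : Set V} (h : ∀ S : Finset V, Separates G A B S → n ≤ S.card) : Linked G A B n := by
  by_cases hsep : ∀ S : Finset V, Separates G' A B S → n ≤ S.card
  · exact (ih A B hsep).mono hle
  push Not at hsep
  obtain ⟨S, hS, hSn⟩ := hsep
  have hnS : ¬ Separates G A B S := fun h' => absurd (h S h') (by omega)
  simp only [Separates] at hnS
  push Not at hnS
  obtain ⟨a₀, ha₀, b₀, hb₀, hab⟩ := hnS
  set R : V → Prop := fun v => ∃ a ∈ A, AvoidReach G' S a v with hR
  have hRS : ∀ v, R v → v ∉ S := by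
    rintro v ⟨a, -, h⟩
    simpa using h.right
  have hRstep : ∀ u v, R u → G'.Adj u v → v ∉ S → R v := by
    rintro u v ⟨a, ha, h⟩ huv hv
    exact ⟨a, ha, h.step huv (by simpa using hv)⟩
  have hRA : ∀ a ∈ A, a ∉ S → R a := fun a ha h => ⟨a, ha, .refl (by simpa using h)⟩
  have hRB : ∀ b ∈ B, ¬ R b := by
    rintro b hb ⟨a, ha, h⟩
    exact hS a ha b hb h
  obtain ⟨x, y, hxy, hRx, hRy, hyS⟩ : ∃ x y, G.Adj x y ∧ R x ∧ ¬ R y ∧ y ∉ S := by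
    by_contra hcon
    push Not at hcon
    refine hRB b₀ hb₀ (hab.induct (P := R) (hRA _ ha₀ (by simpa using hab.1)) ?_)
    intro u v _ hu huv hv
    by_contra hRv
    exact hv (by simpa using hcon u v huv hu hRv)
  have hnG' : ¬ G'.Adj x y := fun h => hRy (hRstep _ _ hRx h hyS)
  have hG2 : ∀ u v, G.Adj u v → G'.Adj u v ∨ (u = x ∧ v = y) ∨ (u = y ∧ v = x) := by
    intro u v huv
    rcases hG x y hxy with h1 | ⟨rfl, rfl⟩ | ⟨rfl, rfl⟩
    · exact absurd h1 hnG'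
    · exact hG u v huv
    · rcases hG u v huv with h | h | h
      · exact .inl h
      · exact .inr (.inr h)
      · exact .inr (.inl h)
  have hxS := hRS x hRx
  have hsep1 : Separates G A B (insert x S : Finset V) := by
    intro a ha b hb hab
    refine hRB b hb (hab.induct (P := R) (hRA _ ha ?_) ?_)
    · have := hab.1
      simp at this
      exact this.2
    · intro u v hau hu huv hv
      simp at hv
      rcases hG2 u v huv with h | ⟨rfl, rfl⟩ | ⟨rfl, rfl⟩
      · exact hRstep _ _ hu h hv.2
      · exact absurd hau.right (by simp)
      · exact absurd rfl hv.1
  have hcard : S.card + 1 = n := by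
    have := h _ hsep1
    rw [Finset.card_insert_of_notMem hxS] at this
    omega
  subst hcard
  refine menger_glue hle hxy hxS hyS hS (ih _ _ ?_) (ih _ _ ?_)
  · intro T hT
    refine h T fun a ha b hb hab => hRB b hb
      (hab.induct (P := fun v => AvoidReach G' T a v ∧ R v) ?_ ?_).2
    · refine ⟨.refl hab.1, hRA a ha fun haS => ?_⟩
      exact hT a ha a (by simp [haS]) (.refl hab.1)
    · rintro u v - ⟨hu, hRu⟩ huv hv
      rcases hG2 u v huv with h | ⟨rfl, rfl⟩ | ⟨rfl, rfl⟩
      · refine ⟨hu.step h hv, hRstep _ _ hRu h fun hvS => ?_⟩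
        exact hT a ha v (by simp [hvS]) (hu.step h hv)
      · exact absurd hu (hT a ha _ (by simp))
      · exact absurd hRu hRy
  · intro T hT
    refine h T fun a ha b hb hab => ?_
    have key := hab.symm.induct (P := fun v => AvoidReach G' T b v ∧ ¬ R v ∧ v ∉ S) ?_ ?_
    · exact key.2.1 (hRA a ha key.2.2)
    · refine ⟨.refl hab.right, hRB b hb, fun hbS => ?_⟩
      exact hT b (by simp [hbS]) b hb (.refl hab.right)
    · rintro u v - ⟨hu, hRu, huS⟩ huv hv
      rcases hG2 u v huv with h | ⟨rfl, rfl⟩ | ⟨rfl, rfl⟩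
      · refine ⟨hu.step h hv, fun hRv => hRu (hRstep _ _ hRv h.symm huS), fun hvS => ?_⟩
        exact hT v (by simp [hvS]) b hb (hu.step h hv).symm
      · exact absurd hRx hRu
      · exact absurd hu.symm (hT _ (by simp) b hb)

lemma menger_fromEdgeSet {n : ℕ} (E : Finset (Sym2 V)) :
    ∀ A B : Set V, (∀ S : Finset V, Separates (fromEdgeSet (E : Set (Sym2 V))) A B S → n ≤ S.card) →
      Linked (fromEdgeSet (E : Set (Sym2 V))) A B n := by
  classical
  induction E using Finset.induction_on with
  | empty =>
    intro A B h
    obtain ⟨F, hF, hFn⟩ : ∃ F : Finset V, (F : Set V) ⊆ A ∩ B ∧ F.card = n := by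
      by_cases hfin : (A ∩ B).Finite
      · have h1 := h hfin.toFinset (by
          intro a ha b hb hab
          have h2 : b = a := by
            refine hab.induct (P := fun v => v = a) rfl ?_
            intro u v _ _ huv
            simp at huv
          subst h2
          exact hab.1 (by simp [ha, hb]))
        obtain ⟨F, hF, hc⟩ := Finset.exists_subset_card_eq h1
        exact ⟨F, fun v hv => by simpa using hF hv, hc⟩
      · exact Set.Infinite.exists_subset_card_eq hfin n
    let e := (Finset.equivFinOfCardEq hFn).symm
    refine ⟨fun i => e i, fun i => e i, fun i => .nil, fun i => (hF (e i).2).1,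
      fun i => (hF (e i).2).2, fun i => by simp, ?_⟩
    intro i j hij v hv hv'
    simp only [Walk.support_nil, List.mem_singleton] at hv hv'
    exact hij (e.injective (Subtype.ext (hv.symm.trans hv')))
  | insert e E he ih =>
    intro A B h
    induction e with | _ x y =>
    refine menger_step (x₀ := x) (y₀ := y) (fromEdgeSet_mono (by simp)) ?_ ih h
    intro u v huv
    simp only [Finset.coe_insert, fromEdgeSet_adj, Set.mem_insert_iff, Sym2.eq_iff] at huv ⊢
    tauto

/-- The theorem of Menger for possibly infinite graphs and finitely many paths. -/
lemma menger {G : SimpleGraph V} {A B : Set V} {n : ℕ}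
    (h : ∀ S : Finset V, Separates G A B S → n ≤ S.card) : Linked G A B n := by
  classical
  by_contra hL
  have hall : ∀ E : Finset (Sym2 V), ∃ S : Finset V,
      Separates (fromEdgeSet ((E.filter (· ∈ G.edgeSet) : Finset _) : Set (Sym2 V))) A B S ∧
        S.card < n := by
    intro E
    by_contra hcon
    push Not at hcon
    refine hL ((menger_fromEdgeSet _ A B hcon).mono ?_)
    intro u v huv
    simp at huv
    exact huv.1.2
  choose S hS hSn using hall
  let U : Ultrafilter (Finset (Sym2 V)) := Ultrafilter.of (Filter.atTop : Filter (Finset (Sym2 V)))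
  have hU : (U : Filter (Finset (Sym2 V))) ≤ Filter.atTop := Ultrafilter.of_le Filter.atTop
  set S' : Set V := {v | ∀ᶠ E in U, v ∈ S E} with hS'
  have hfin : ∀ F : Finset V, (F : Set V) ⊆ S' → F.card < n := by
    intro F hF
    have h1 : ∀ᶠ E in U, ∀ v ∈ F, v ∈ S E := by
      rw [Filter.eventually_all_finset]
      exact fun v hv => hF hv
    obtain ⟨E, hE⟩ := h1.exists
    exact (Finset.card_le_card (fun v hv => hE v hv)).trans_lt (hSn E)
  have hfinite : S'.Finite := by
    by_contra hinf
    obtain ⟨F, hF, hc⟩ := Set.Infinite.exists_subset_card_eq hinf n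
    exact absurd (hfin F hF) (by omega)
  have := h hfinite.toFinset ?_
  · exact absurd (hfin hfinite.toFinset (by simp)) (by omega)
  · intro a ha b hb hab
    rw [Set.Finite.coe_toFinset] at hab
    have key := hab.induct (P := fun v => ∀ᶠ E in U, AvoidReach
      (fromEdgeSet ((E.filter (· ∈ G.edgeSet) : Finset _) : Set (Sym2 V))) (S E) a v) ?_ ?_
    · obtain ⟨E, hE⟩ := key.exists
      exact hS E a ha b hb hE
    · have := hab.1
      rw [hS', Set.mem_ofPred_eq, ← Ultrafilter.eventually_not] at this
      filter_upwards [this] with E hE using .refl (by simpa using hE)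
    · intro u v _ hu huv hv
      rw [hS', Set.mem_ofPred_eq, ← Ultrafilter.eventually_not] at hv
      have h2 : ∀ᶠ E : Finset (Sym2 V) in (U : Filter (Finset (Sym2 V))), s(u, v) ∈ E :=
        hU ((Filter.eventually_ge_atTop ({s(u, v)} : Finset (Sym2 V))).mono fun E hE =>
          Finset.singleton_subset_iff.1 hE)
      filter_upwards [hu, hv, h2] with E h3 h4 h5
      refine h3.step ?_ (by simpa using h4)
      simp [h5, huv, huv.ne]

/-- Successor relations with unique predecessors have disjoint injective forward orbits. -/
lemma exists_disjoint_orbits {ι : Type*} {B : V → V → Prop}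
    (hin : ∀ x x' y, B x y → B x' y → x = x') (hout : ∀ x y, B x y → ∃ z, B y z)
    {s : ι → V} (hs : Function.Injective s) (hsout : ∀ i, ∃ z, B (s i) z)
    (hsin : ∀ i x, ¬ B x (s i)) :
    ∃ ρ : ι → ℕ → V, (∀ i, ρ i 0 = s i) ∧ (∀ i n, B (ρ i n) (ρ i (n + 1))) ∧
      ∀ i j m n, ρ i m = ρ j n → i = j ∧ m = n := by
  classical
  let next : V → V := fun x => if h : ∃ z, B x z then h.choose else x
  have hnext : ∀ x, (∃ z, B x z) → B x (next x) := fun x h => by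
    simp only [next, dif_pos h]
    exact h.choose_spec
  have hB : ∀ i n, B (next^[n] (s i)) (next^[n + 1] (s i)) := by
    intro i n
    induction n with
    | zero => exact hnext _ (hsout i)
    | succ n ih =>
      rw [Function.iterate_succ_apply' next (n + 1)]
      exact hnext _ (hout _ _ ih)
  refine ⟨fun i n => next^[n] (s i), fun i => rfl, hB, ?_⟩
  intro i j m
  induction m with
  | zero =>
    intro n h
    cases n with
    | zero => exact ⟨hs h, rfl⟩
    | succ n => exact absurd ((congrArg (B (next^[n] (s j))) h).mpr (hB j n)) (hsin _ _)
  | succ m ih =>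
    intro n h
    cases n with
    | zero => exact absurd ((congrArg (B (next^[m] (s i))) h).mp (hB i m)) (hsin _ _)
    | succ n =>
      obtain ⟨h1, h2⟩ := ih n (hin _ _ _ (hB i m)
        ((congrArg (B (next^[n] (s j))) h).mpr (hB j n)))
      exact ⟨h1, by rw [h2]⟩

lemma AvoidReach.along {G : SimpleGraph V} {S : Set V} {f : ℕ → V} {a i : ℕ}
    (hf : ∀ n, G.Adj (f n) (f (n + 1))) (h : ∀ j, a ≤ j → f j ∉ S) (hi : a ≤ i) :
    AvoidReach G S (f a) (f i) := by
  induction i, hi using Nat.le_induction with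
  | base => exact .refl (h a le_rfl)
  | succ n hn ih => exact ih.step (hf n) (h _ (by omega))

/-- The vertices which are joined to a tail of `W` by walks avoiding `T`. -/
def endSide (G : SimpleGraph V) (W : ℕ → V) (T : Set V) : Set V :=
  {v | ∀ᶠ i in Filter.atTop, AvoidReach G T v (W i)}

section endSide

variable {G : SimpleGraph V} {W : ℕ → V}

lemma endSide_notMem {T : Set V} {v : V} (h : v ∈ endSide G W T) : v ∉ T := by
  obtain ⟨i, hi⟩ := Filter.Eventually.exists h
  exact hi.1

lemma endSide_adj {T : Set V} {u v : V} (h : v ∈ endSide G W T) (huv : G.Adj v u) (hu : u ∉ T) :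
    u ∈ endSide G W T :=
  Filter.Eventually.mono h fun _ hi => hi.head huv.symm hu

lemma endSide_reach {T : Set V} {u v : V} (h : v ∈ endSide G W T) (huv : AvoidReach G T v u) :
    u ∈ endSide G W T :=
  Filter.Eventually.mono h fun _ hi => huv.symm.trans hi

lemma endSide_antitone {T T' : Set V} (h : T ⊆ T') : endSide G W T' ⊆ endSide G W T :=
  fun _ hv => Filter.Eventually.mono hv fun _ hi => hi.mono le_rfl h

lemma eventually_mem_endSide (hW : ∀ n, G.Adj (W n) (W (n + 1))) {r : ℕ → V}
    (hr : ∀ n, G.Adj (r n) (r (n + 1))) (h : RayEquiv G W r) {T : Set V} (hT : T.Finite) :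
    ∀ᶠ n in Filter.atTop, r n ∈ endSide G W T := by
  obtain ⟨a, b, ha, hb, w, hw⟩ := h hT.toFinset
  simp only [Set.Finite.mem_toFinset] at ha hb hw
  have hab := AvoidReach.of_walk w hw
  filter_upwards [Filter.eventually_ge_atTop b] with n hn
  filter_upwards [Filter.eventually_ge_atTop a] with i hi
  exact (hab.trans (AvoidReach.along hr hb hn)).symm.trans (AvoidReach.along hW ha hi)

lemma eventually_notMem_of_injective {r : ℕ → V} (hr : Function.Injective r) {S : Set V}
    (hS : S.Finite) : ∃ b, ∀ j, b ≤ j → r j ∉ S := by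
  have := hr.tendsto_cofinite.eventually hS.compl_mem_cofinite
  rw [Nat.cofinite_eq_atTop] at this
  exact Filter.eventually_atTop.1 this

lemma rayEquiv_of_frequently (hW : IsRay G W) {r : ℕ → V} (hr : IsRay G r)
    (h : ∀ S : Finset V, ∃ᶠ n in Filter.atTop, r n ∈ endSide G W S) : RayEquiv G W r := by
  intro S
  obtain ⟨a, ha⟩ := eventually_notMem_of_injective hW.1 S.finite_toSet
  obtain ⟨b, hb⟩ := eventually_notMem_of_injective hr.1 S.finite_toSet
  obtain ⟨m, hm, hmS⟩ := (Filter.frequently_atTop.1 (h S)) b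
  obtain ⟨i, hi, hia⟩ := (Filter.Eventually.and hmS (Filter.eventually_ge_atTop a)).exists
  have key := ((AvoidReach.along hr.2 hb hm).trans hi).symm
  obtain ⟨w, hw⟩ := ((AvoidReach.along hW.2 ha hia).trans key).exists_walk
  exact ⟨a, b, fun i hi => by simpa using ha i hi, fun i hi => by simpa using hb i hi, w,
    fun v hv => by simpa using hw v hv⟩

lemma rayEquiv_self (hW : IsRay G W) : RayEquiv G W W := by
  intro S
  obtain ⟨a, ha⟩ := eventually_notMem_of_injective hW.1 S.finite_toSet
  exact ⟨a, a, ha, ha, .nil, by simpa using ha a le_rfl⟩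

lemma endSide_subset_of_disjoint {Y T' : Set V} (h : Disjoint Y (endSide G W T')) :
    endSide G W T' ⊆ endSide G W Y := by
  intro v hv
  refine Filter.Eventually.mono hv fun i hi => ?_
  refine (hi.induct (P := fun x => x ∈ endSide G W T' ∧ AvoidReach G Y v x)
    ⟨hv, .refl (Set.disjoint_right.1 h hv)⟩ ?_).2
  rintro x y - ⟨hx, hx'⟩ hxy hy
  have := endSide_adj hx hxy hy
  exact ⟨this, hx'.step hxy (Set.disjoint_right.1 h this)⟩

lemma endSide_subset_union (hW : IsRay G W) {T R : Set V} (hT : T.Finite) (hR : R.Finite)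
    (h : ∀ u ∈ endSide G W (T ∪ R), ∀ v ∈ R, ¬ G.Adj u v) :
    endSide G W T ⊆ endSide G W (T ∪ R) := by
  intro v hv
  obtain ⟨i, hi, hiC⟩ := (Filter.Eventually.and hv
    (eventually_mem_endSide hW.2 hW.2 (rayEquiv_self hW) (hT.union hR))).exists
  refine hi.symm.induct (P := fun x => x ∈ endSide G W (T ∪ R)) hiC ?_
  intro x y _ hx hxy hy
  exact endSide_adj hx hxy fun hy' => hy'.elim hy fun hyR => h x hx y hyR hxy

/-- The vertices which dominate the end of `W`. -/
def endDom (G : SimpleGraph V) (W : ℕ → V) : Set V :=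
  {z | ∀ T : Finset V, z ∉ T → z ∈ endSide G W T}

lemma exists_min_separator (hW : IsRay G W) (X : Finset V) :
    ∃ T : Finset V, Disjoint (X : Set V) (endSide G W T) ∧
      (∀ T' : Finset V, Disjoint (X : Set V) (endSide G W T') → T.card ≤ T'.card) ∧
      (∀ z ∈ endDom G W, z ∈ X → z ∈ T) ∧
      ∀ Y : Set V, Y ⊆ X → endSide G W T ⊆ endSide G W Y ∧ ∀ t ∈ T, t ∈ Y ∨ t ∈ endSide G W Y := by
  classical
  have hex : ∃ n, ∃ T : Finset V, T.card = n ∧ Disjoint (X : Set V) (endSide G W T) :=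
    ⟨_, X, rfl, Set.disjoint_right.2 fun v hv => endSide_notMem hv⟩
  obtain ⟨T, hT, hTX⟩ := Nat.find_spec hex
  have hmin : ∀ T' : Finset V, Disjoint (X : Set V) (endSide G W T') → T.card ≤ T'.card := by
    intro T' hT'
    rw [hT]
    exact Nat.find_min' hex ⟨T', rfl, hT'⟩
  have hnb : ∀ t ∈ T, ∃ u ∈ endSide G W T, G.Adj u t := by
    intro t ht
    by_contra hcon
    push Not at hcon
    have heq : ((T.erase t : Finset V) : Set V) ∪ {t} = T := by
      rw [← Finset.coe_singleton, ← Finset.coe_union]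
      congr 1
      ext x
      simp only [Finset.mem_union, Finset.mem_erase, Finset.mem_singleton]
      by_cases hx : x = t <;> simp [hx, ht]
    have h1 := endSide_subset_union (G := G) hW (T.erase t).finite_toSet (Set.finite_singleton t)
      (by
        rw [heq]
        intro u hu v hv
        rw [Set.mem_singleton_iff.1 hv]
        exact hcon u hu)
    rw [heq] at h1
    have h2 := hmin _ (hTX.mono_right h1)
    rw [Finset.card_erase_of_mem ht] at h2
    have := Finset.card_pos.2 ⟨t, ht⟩
    omega
  refine ⟨T, hTX, hmin, ?_, ?_⟩
  · intro z hz hzX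
    by_contra hzT
    exact Set.disjoint_left.1 hTX (by simpa using hzX) (hz T hzT)
  · intro Y hY
    have h1 : endSide G W T ⊆ endSide G W Y := endSide_subset_of_disjoint (hTX.mono_left hY)
    refine ⟨h1, fun t ht => ?_⟩
    obtain ⟨u, hu, hut⟩ := hnb t ht
    by_cases htY : t ∈ Y
    · exact .inl htY
    · exact .inr (endSide_adj (h1 hu) hut htY)

lemma exists_disjoint_separator (hW : IsRay G W) (X : Finset V)
    (hX : Disjoint (X : Set V) (endDom G W)) :
    ∃ Y : Finset V, Disjoint X Y ∧ Disjoint (X : Set V) (endSide G W Y) := by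
  classical
  have h : ∀ v, ∃ Y : Finset V, v ∈ X → v ∉ Y ∧ v ∉ endSide G W Y := by
    intro v
    by_cases hv : v ∈ X
    · have := Set.disjoint_left.1 hX (Finset.mem_coe.2 hv)
      simp only [endDom, Set.mem_ofPred_eq] at this
      push Not at this
      obtain ⟨Y, hY⟩ := this
      exact ⟨Y, fun _ => hY⟩
    · exact ⟨∅, fun h => absurd h hv⟩
  choose Y hY using h
  set Y₁ := X.biUnion Y with hY₁
  have hsub : ∀ v ∈ X, endSide G W Y₁ ⊆ endSide G W (Y v) := fun v hv =>
    endSide_antitone (by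
      rw [Finset.coe_subset]
      exact Finset.subset_biUnion_of_mem Y hv)
  have heq : ((Y₁ \ X : Finset V) : Set V) ∪ ((Y₁ ∩ X : Finset V) : Set V) = Y₁ := by
    rw [← Finset.coe_union, Finset.sdiff_union_inter]
  refine ⟨Y₁ \ X, Finset.disjoint_sdiff, ?_⟩
  have key := endSide_subset_union (G := G) hW (Y₁ \ X).finite_toSet (Y₁ ∩ X).finite_toSet (by
    rw [heq]
    intro u hu v hv huv
    have hvX : v ∈ X := (Finset.mem_inter.1 (by simpa using hv)).2
    exact (hY v hvX).2 (endSide_adj (hsub v hvX hu) huv (by simpa using (hY v hvX).1)))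
  rw [heq] at key
  rw [Set.disjoint_left]
  intro v hv hvC
  exact (hY v (by simpa using hv)).2 (hsub v (by simpa using hv) (key hvC))

/-- Beyond any finite separator containing the dominating vertices there is a further one. -/
lemma exists_next_separator (hW : IsRay G W) {Z : Finset V} (hZ : (Z : Set V) = endDom G W)
    (T : Finset V) (hZT : Z ⊆ T) (v : V) :
    ∃ T' X : Finset V, Z ⊆ T' ∧ T ⊆ X ∧ Disjoint (X : Set V) (endSide G W T') ∧
      (∀ T'' : Finset V, Disjoint (X : Set V) (endSide G W T'') → T'.card ≤ T''.card) ∧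
      endSide G W T' ⊆ endSide G W T ∧ v ∉ endSide G W T' ∧
      ∀ t ∈ T', t ∉ Z → t ∈ endSide G W T := by
  classical
  obtain ⟨Y, hY, hYC⟩ := exists_disjoint_separator hW (T \ Z) (by
    rw [← hZ, Finset.disjoint_coe]
    exact Finset.sdiff_disjoint)
  obtain ⟨T', h1, h2, h3, h4⟩ := exists_min_separator hW (insert v (T ∪ Y))
  have hTX : T ⊆ insert v (T ∪ Y) := fun x hx => by simp [hx]
  refine ⟨T', _, ?_, hTX, h1, h2, (h4 T (by exact_mod_cast hTX)).1, ?_, ?_⟩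
  · intro z hz
    exact h3 z (by rw [← hZ]; exact_mod_cast hz) (hTX (hZT hz))
  · exact Set.disjoint_left.1 h1 (by simp)
  · intro t ht htZ
    rcases (h4 T (by exact_mod_cast hTX)).2 t ht with h | h
    · exfalso
      have htT : t ∈ T \ Z := by simpa [htZ] using h
      rcases (h4 Y (fun x hx => by simp at hx; simp [hx])).2 t ht with h' | h'
      · exact Finset.disjoint_left.1 hY htT (by simpa using h')
      · exact Set.disjoint_left.1 hYC (by simpa using htT) h'
    · exact h

end endSide

lemma exists_rays_of_segments [Countable V] {G : SimpleGraph V} {W : ℕ → V} (hW : IsRay G W)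
    {n : ℕ} (P : Set V → (Fin n → V) → Prop)
    (hP : ∀ U L, P U L → (∀ i, L i ∈ U) ∧ Function.Injective L) (h0 : ∃ U L, P U L)
    (hstep : ∀ U L v, P U L → ∃ U' L', P U' L' ∧ insert v U ⊆ U' ∧ (∀ i, L' i ≠ L i) ∧
      ∃ p : ∀ i, G.Walk (L i) (L' i), (∀ i, (p i).IsPath) ∧
        (∀ i j, i ≠ j → ∀ x ∈ (p i).support, x ∉ (p j).support) ∧
        ∀ i, ∀ y ∈ (p i).support, y ≠ L i →
          y ∈ U' ∧ y ∉ U ∧ ∀ S : Finset V, (S : Set V) ⊆ U → y ∈ endSide G W S) :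
    ∃ F : Fin n → ℕ → V, (∀ i, IsRay G (F i) ∧ RayEquiv G W (F i)) ∧
      Pairwise fun i j => Disjoint (Set.range (F i)) (Set.range (F j)) := by
  have : Nonempty V := ⟨W 0⟩
  obtain ⟨e, he⟩ := exists_surjective_nat V
  obtain ⟨U₀, L₀, h0⟩ := h0
  have hstep' : ∀ (s : {s : Set V × (Fin n → V) // P s.1 s.2}) (v : V),
      ∃ s' : {s : Set V × (Fin n → V) // P s.1 s.2}, insert v s.1.1 ⊆ s'.1.1 ∧
        (∀ i, s'.1.2 i ≠ s.1.2 i) ∧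
        ∃ p : ∀ i, G.Walk (s.1.2 i) (s'.1.2 i), (∀ i, (p i).IsPath) ∧
        (∀ i j, i ≠ j → ∀ x ∈ (p i).support, x ∉ (p j).support) ∧
        ∀ i, ∀ y ∈ (p i).support, y ≠ s.1.2 i →
          y ∈ s'.1.1 ∧ y ∉ s.1.1 ∧ ∀ S : Finset V, (S : Set V) ⊆ s.1.1 → y ∈ endSide G W S := by
    rintro ⟨⟨U, L⟩, hs⟩ v
    obtain ⟨U', L', h1, h2⟩ := hstep U L v hs
    exact ⟨⟨⟨U', L'⟩, h1⟩, h2⟩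
  choose nx hnx using hstep'
  let st : ℕ → {s : Set V × (Fin n → V) // P s.1 s.2} :=
    fun m => Nat.rec ⟨⟨U₀, L₀⟩, h0⟩ (fun m s => nx s (e m)) m
  have hst : ∀ m, _ := fun m => hnx (st m) (e m)
  change ∀ m, insert (e m) (st m).1.1 ⊆ (st (m + 1)).1.1 ∧
        (∀ i, (st (m + 1)).1.2 i ≠ (st m).1.2 i) ∧
        ∃ p : ∀ i, G.Walk ((st m).1.2 i) ((st (m + 1)).1.2 i), (∀ i, (p i).IsPath) ∧
        (∀ i j, i ≠ j → ∀ x ∈ (p i).support, x ∉ (p j).support) ∧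
        ∀ i, ∀ y ∈ (p i).support, y ≠ (st m).1.2 i →
          y ∈ (st (m + 1)).1.1 ∧ y ∉ (st m).1.1 ∧
            ∀ S : Finset V, (S : Set V) ⊆ (st m).1.1 → y ∈ endSide G W S at hst
  have hL : ∀ m, (∀ i, (st m).1.2 i ∈ (st m).1.1) ∧ Function.Injective (st m).1.2 :=
    fun m => hP _ _ (st m).2
  generalize hUdef : (fun m => (st m).1.1) = U at *
  generalize hLdef : (fun m => (st m).1.2) = L at *
  have hst' : ∀ m, insert (e m) (U m) ⊆ U (m + 1) ∧
        (∀ i, L (m + 1) i ≠ L m i) ∧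
        ∃ p : ∀ i, G.Walk (L m i) (L (m + 1) i), (∀ i, (p i).IsPath) ∧
        (∀ i j, i ≠ j → ∀ x ∈ (p i).support, x ∉ (p j).support) ∧
        ∀ i, ∀ y ∈ (p i).support, y ≠ L m i →
          y ∈ U (m + 1) ∧ y ∉ U m ∧
            ∀ S : Finset V, (S : Set V) ⊆ U m → y ∈ endSide G W S := by
    subst hUdef hLdef
    exact hst
  have hLU : ∀ m i, L m i ∈ U m := by
    subst hUdef hLdef
    exact fun m => (hL m).1
  have hLi : ∀ m, Function.Injective (L m) := by
    subst hLdef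
    exact fun m => (hL m).2
  clear hst hL hUdef hLdef st hnx nx hstep hP h0 P
  choose hU hne p hp hpd hpU using hst'
  have hmono : Monotone U :=
    monotone_nat_of_le_succ fun m => (Set.subset_insert _ _).trans (hU m)
  have heU : ∀ m, e m ∈ U (m + 1) := fun m => hU m (Set.mem_insert _ _)
  let B : V → V → Prop := fun x y => ∃ m i j, j < (p m i).length ∧
    (p m i).getVert j = x ∧ (p m i).getVert (j + 1) = y
  have hv : ∀ m i j, j < (p m i).length → (p m i).getVert (j + 1) ≠ L m i := by
    intro m i j hj h
    have := (hp m i).getVert_injOn (x₁ := j + 1) (x₂ := 0) (by simp; omega) (by simp)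
      (by simpa using h)
    omega
  have hvU : ∀ m i j, j < (p m i).length → (p m i).getVert (j + 1) ∈ U (m + 1) ∧
      (p m i).getVert (j + 1) ∉ U m ∧
      ∀ S : Finset V, (S : Set V) ⊆ U m → (p m i).getVert (j + 1) ∈ endSide G W S :=
    fun m i j hj => hpU m i _ ((p m i).getVert_mem_support _) (hv m i j hj)
  have hlen : ∀ m i, 0 < (p m i).length := by
    intro m i
    by_contra h
    exact hne m i (Walk.eq_of_length_eq_zero (p := p m i) (by omega)).symm
  obtain ⟨ρ, hρ0, hρB, hρi⟩ := exists_disjoint_orbits (B := B) (s := L 0) (by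
      rintro x x' y ⟨m, i, j, hj, rfl, rfl⟩ ⟨m', i', j', hj', rfl, h⟩
      have h1 := hvU m i j hj
      have h2 := hvU m' i' j' hj'
      rw [h] at h2
      have hm : m = m' := by
        rcases lt_trichotomy m m' with hlt | rfl | hlt
        · exact absurd (hmono (show m + 1 ≤ m' by omega) h1.1) h2.2.1
        · rfl
        · exact absurd (hmono (show m' + 1 ≤ m by omega) h2.1) h1.2.1
      subst hm
      have hi : i = i' := by
        by_contra hi
        exact hpd m i i' hi _ ((p m i).getVert_mem_support _) (h ▸ (p m i').getVert_mem_support _)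
      subst hi
      have hjj := (hp m i).getVert_injOn (by simp; omega) (by simp; omega) h
      have : j = j' := by omega
      rw [this]) (by
      rintro x y ⟨m, i, j, hj, rfl, rfl⟩
      by_cases hj' : j + 1 < (p m i).length
      · exact ⟨_, m, i, j + 1, hj', rfl, rfl⟩
      · have : j + 1 = (p m i).length := by omega
        exact ⟨_, m + 1, i, 0, hlen _ _, by simp [this], rfl⟩) (hLi 0) (fun i =>
      ⟨_, 0, i, 0, hlen _ _, by simp, rfl⟩) (by
      rintro i x ⟨m, i', j, hj, -, h⟩
      exact (hvU m i' j hj).2.1 (h ▸ hmono (Nat.zero_le m) (hLU 0 i)))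
  have hρG : ∀ i, IsRay G (ρ i) := by
    refine fun i => ⟨fun a b hab => (hρi i i a b hab).2, fun k => ?_⟩
    obtain ⟨m, i', j, hj, h1, h2⟩ := hρB i k
    rw [← h1, ← h2]
    exact (p m i').adj_getVert_succ hj
  refine ⟨ρ, fun i => ⟨hρG i, rayEquiv_of_frequently hW (hρG i) fun S => ?_⟩, ?_⟩
  · obtain ⟨M, hM⟩ : ∃ M, (S : Set V) ⊆ U M := by
      classical
      induction S using Finset.induction_on with
      | empty => exact ⟨0, by simp⟩
      | insert a S _ ih =>
        obtain ⟨M, hM⟩ := ih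
        obtain ⟨m, rfl⟩ := he a
        refine ⟨max M (m + 1), ?_⟩
        intro x hx
        simp only [Finset.coe_insert, Set.mem_insert_iff] at hx
        rcases hx with rfl | hx
        · exact hmono (le_max_right _ _) (heU m)
        · exact hmono (le_max_left _ _) (hM hx)
    have hfin : Set.Finite (⋃ m ∈ Finset.range M, ⋃ i, {x | x ∈ (p m i).support}) :=
      Set.Finite.biUnion (Finset.finite_toSet _) fun m _ =>
        Set.finite_iUnion fun i => List.finite_toSet _
    obtain ⟨b, hb⟩ := eventually_notMem_of_injective (hρG i).1 hfin
    refine Filter.Eventually.frequently ?_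
    filter_upwards [Filter.eventually_ge_atTop (b + 1)] with k hk
    obtain ⟨k, rfl⟩ : ∃ k', k = k' + 1 := ⟨k - 1, by omega⟩
    obtain ⟨m, i', j, hj, h1, h2⟩ := hρB i k
    rw [← h2]
    refine (hvU m i' j hj).2.2 S (hM.trans (hmono ?_))
    by_contra hlt
    refine hb (k + 1) (by omega) ?_
    simp only [Set.mem_iUnion, Finset.mem_range]
    exact ⟨m, by omega, i', by rw [← h2]; exact (p m i').getVert_mem_support _⟩
  · intro i j hij
    rw [Set.disjoint_left]
    rintro _ ⟨a, rfl⟩ ⟨b, hb⟩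
    exact hij (hρi j i b a hb).1.symm

/-- The theorem of Menger for paths starting in prescribed vertices and avoiding a set `X`. -/
lemma menger_avoiding {G : SimpleGraph V} {n : ℕ} {L : Fin n → V}
    {B X : Set V} (hX : ∀ i, L i ∉ X)
    (h : ∀ S : Finset V, S.card < n → ∃ i, ∃ b ∈ B, AvoidReach G (S ∪ X) (L i) b) :
    ∃ (b : Fin n → V) (p : ∀ i, G.Walk (L i) (b i)), (∀ i, b i ∈ B) ∧ (∀ i, (p i).IsPath) ∧
      (∀ i j, i ≠ j → ∀ x ∈ (p i).support, x ∉ (p j).support) ∧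
      ∀ i, ∀ x ∈ (p i).support, x ∉ X := by
  classical
  let G' : SimpleGraph V :=
    { Adj := fun u v => G.Adj u v ∧ u ∉ X ∧ v ∉ X
      symm := ⟨fun u v h => ⟨h.1.symm, h.2.2, h.2.1⟩⟩
      loopless := ⟨fun u h => h.1.ne rfl⟩ }
  have hle : G' ≤ G := fun u v h => h.1
  have hsup : ∀ {a b} (w : G'.Walk a b), a ∉ X → ∀ x ∈ w.support, x ∉ X := by
    intro a b w
    induction w with
    | nil => intro h x hx; simp at hx; exact hx ▸ h
    | cons hadj q ih =>
      intro ha x hx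
      simp only [Walk.support_cons, List.mem_cons] at hx
      rcases hx with rfl | hx
      · exact ha
      · exact ih hadj.2.2 x hx
  have hlinked : Linked G' (Set.range L) B n := by
    refine menger fun S hS => ?_
    by_contra hlt
    obtain ⟨i, b, hb, hab⟩ := h S (by omega)
    refine hS _ ⟨i, rfl⟩ b hb (hab.induct (P := fun x => AvoidReach G' S (L i) x) ?_ ?_)
    · exact .refl fun h => hab.1 (.inl h)
    · intro u v hu hu' huv hv
      exact hu'.step ⟨huv, fun h => hu.right (.inr h), fun h => hv (.inr h)⟩
        fun h => hv (.inl h)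
  obtain ⟨a, b, p, ha, hb, hp, hpd⟩ := hlinked
  choose φ hφ using ha
  have hφi : Function.Injective φ := by
    intro i j hij
    by_contra hne
    refine hpd i j hne (a i) (by simp) ?_
    rw [← hφ i, hij, hφ j]
    simp
  have hφs := Finite.surjective_of_injective hφi
  choose ψ hψ using hφs
  have hψi : Function.Injective ψ := fun i j hij => by rw [← hψ i, hij, hψ]
  have hLψ : ∀ i, a (ψ i) = L i := fun i => by rw [← hφ, hψ]
  refine ⟨fun i => b (ψ i), fun i => ((p (ψ i)).mapLe hle).copy (hLψ i) rfl, fun i => hb _,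
    fun i => ?_, fun i j hij x hx hx' => ?_, fun i x hx => ?_⟩
  · rw [Walk.isPath_copy, Walk.isPath_mapLe]
    exact hp _
  · simp only [Walk.support_copy, Walk.support_mapLe_eq_support] at hx hx'
    exact hpd _ _ (hψi.ne hij) x hx hx'
  · simp only [Walk.support_copy, Walk.support_mapLe_eq_support] at hx
    exact hsup _ (by rw [hLψ]; exact hX i) x hx

lemma AvoidReach.of_dropUntil {G : SimpleGraph V} {a b y : V} {S : Set V} {p : G.Walk a b}
    (hp : p.IsPath) (hy : y ∈ p.support) (hya : y ≠ a)
    (h : ∀ x ∈ p.support, x ≠ a → x ∉ S) : AvoidReach G S y b := by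
  classical
  refine AvoidReach.of_walk (p.dropUntil y hy) fun x hx => ?_
  refine h x (p.support_dropUntil_subset_support hy hx) ?_
  rintro rfl
  exact hya (Walk.IsPath.eq_start_of_mem_dropUntil hp hy hx)

lemma AvoidReach.of_takeUntil {G : SimpleGraph V} {a b y : V} {S : Set V} {p : G.Walk a b}
    (hp : p.IsPath) (hy : y ∈ p.support) (hyb : y ≠ b)
    (h : ∀ x ∈ p.support, x ≠ b → x ∉ S) : AvoidReach G S a y := by
  classical
  refine AvoidReach.of_walk (p.takeUntil y hy) fun x hx => ?_
  refine h x (p.support_takeUntil_subset_support hy hx) ?_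
  rintro rfl
  exact hyb (Walk.IsPath.eq_end_of_mem_takeUntil hp hy hx)

lemma exists_injective_of_le_card {F : Finset V} {n : ℕ} (h : n ≤ F.card) :
    ∃ L : Fin n → V, Function.Injective L ∧ ∀ i, L i ∈ F := by
  let e := F.equivFin.symm
  exact ⟨fun i => e (Fin.castLE h i), fun i j hij => by simpa using hij, fun i => (e _).2⟩

section thin

variable {G : SimpleGraph V} {W : ℕ → V} {n : ℕ}

/-- There are `n` disjoint rays equivalent to `W`. -/
def HasDisjointRays (G : SimpleGraph V) (W : ℕ → V) (n : ℕ) : Prop :=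
  ∃ F : Fin n → ℕ → V, (∀ i, IsRay G (F i) ∧ RayEquiv G W (F i)) ∧
      Pairwise fun i j => Disjoint (Set.range (F i)) (Set.range (F j))

lemma hasDisjointRays_of_infinite_endDom [Countable V] (hW : IsRay G W)
    (hZ : (endDom G W).Infinite) : HasDisjointRays G W n := by
  classical
  refine exists_rays_of_segments hW (fun U L => U.Finite ∧ Function.Injective L ∧
    ∀ i, L i ∈ endDom G W ∧ L i ∈ U) (fun U L h => ⟨fun i => (h.2.2 i).2, h.2.1⟩) ?_ ?_
  · obtain ⟨F, hF, hFn⟩ := hZ.exists_subset_card_eq n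
    obtain ⟨L, hL, hLF⟩ := exists_injective_of_le_card hFn.ge
    exact ⟨F, L, F.finite_toSet, hL, fun i => ⟨hF (hLF i), hLF i⟩⟩
  · rintro U L v ⟨hU, hL, hLZ⟩
    obtain ⟨F, hF, hFn⟩ := (hZ.sdiff (hU.insert v)).exists_subset_card_eq n
    have hXfin : (U \ Set.range L).Finite := hU.sdiff
    obtain ⟨L', p, hL', hp, hpd, hpX⟩ := menger_avoiding (G := G) (B := F) (X := U \ Set.range L)
      (fun i hi => hi.2 ⟨i, rfl⟩) (by
        intro S hS
        obtain ⟨i, hi⟩ : ∃ i, L i ∉ S := by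
          by_contra hcon
          push Not at hcon
          have := Finset.card_le_card (s := Finset.univ.image L) (t := S) (by
            intro x hx
            simp only [Finset.mem_image, Finset.mem_univ, true_and] at hx
            obtain ⟨i, rfl⟩ := hx
            exact hcon i)
          rw [Finset.card_image_of_injective _ hL] at this
          simp at this
          omega
        obtain ⟨f, hf, hfS⟩ := Finset.exists_mem_notMem_of_card_lt_card (hS.trans_eq hFn.symm)
        have hT : ∀ z ∈ endDom G W, z ∉ S → z ∉ U \ Set.range L →
            z ∈ endSide G W (S ∪ (U \ Set.range L)) := by
          intro z hz h1 h2
          have := hz (S ∪ hXfin.toFinset) (by simpa using ⟨h1, fun h => by simpa [h] using h2⟩)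
          simpa using this
        have h1 := hT _ (hLZ i).1 hi fun h => h.2 ⟨i, rfl⟩
        have h2 := hT f (hF hf).1 hfS fun h => (hF hf).2 (.inr h.1)
        obtain ⟨m, h3, h4⟩ := (Filter.Eventually.and h1 h2).exists
        exact ⟨i, f, hf, h3.trans h4.symm⟩)
    have hL'U : ∀ i, L' i ∉ insert v U := fun i => (hF (hL' i)).2
    have hpU : ∀ i, ∀ x ∈ (p i).support, x ≠ L i → x ∉ U := by
      intro i x hx hxi hxU
      refine hpX i x hx ⟨hxU, ?_⟩
      rintro ⟨j, rfl⟩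
      exact hpd i j (fun h => hxi (by rw [h])) _ hx (by simp)
    refine ⟨insert v U ∪ ⋃ i, {x | x ∈ (p i).support}, L', ⟨?_, ?_, ?_⟩, Set.subset_union_left,
      ?_, p, hp, hpd, ?_⟩
    · exact (hU.insert v).union (Set.finite_iUnion fun i => List.finite_toSet _)
    · intro i j hij
      by_contra hne
      exact hpd i j hne (L' i) (by simp) (by simp [hij])
    · exact fun i => ⟨(hF (hL' i)).1, .inr (Set.mem_iUnion.2 ⟨i, by simp⟩)⟩
    · intro i h
      exact hL'U i (.inr (h ▸ (hLZ i).2))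
    · intro i y hy hyL
      refine ⟨.inr (Set.mem_iUnion.2 ⟨i, hy⟩), hpU i y hy hyL, fun S hS => ?_⟩
      have h1 : AvoidReach G S y (L' i) := AvoidReach.of_dropUntil (hp i) hy hyL
        fun x hx hxL hxS => hpU i x hx hxL (hS hxS)
      refine endSide_reach ((hF (hL' i)).1 S fun h => hL'U i (.inr (hS h))) h1.symm

lemma hasDisjointRays_of_large_separators [Countable V] (hW : IsRay G W) {Z : Finset V}
    (hZ : (Z : Set V) = endDom G W) (X₀ : Finset V)
    (hX₀ : ∀ T : Finset V, Disjoint (X₀ : Set V) (endSide G W T) → Z.card + n ≤ T.card) :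
    HasDisjointRays G W n := by
  classical
  refine exists_rays_of_segments hW (fun U L => ∃ T : Finset V, Z ⊆ T ∧
    (∀ T' : Finset V, Disjoint (T : Set V) (endSide G W T') → T.card ≤ T'.card) ∧
    Function.Injective L ∧ (∀ i, L i ∈ T ∧ L i ∉ Z) ∧ U = (endSide G W T)ᶜ) ?_ ?_ ?_
  · rintro U L ⟨T, -, -, hL, hLT, rfl⟩
    exact ⟨fun i h => endSide_notMem h (hLT i).1, hL⟩
  · obtain ⟨T, hT, hmin, hZT, -⟩ := exists_min_separator hW (X₀ ∪ Z)
    have hZT' : Z ⊆ T := fun z hz => hZT z (by rw [← hZ]; exact_mod_cast hz) (by simp [hz])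
    have hcard := hX₀ T (hT.mono_left (by simp))
    obtain ⟨L, hL, hLT⟩ := exists_injective_of_le_card (F := T \ Z) (n := n) (by
      rw [Finset.card_sdiff_of_subset hZT']
      omega)
    refine ⟨_, L, T, hZT', fun T' hT' => hmin T' ?_, hL, fun i => by simpa using hLT i, rfl⟩
    exact hT.mono_right (endSide_subset_of_disjoint hT') |>.mono_right le_rfl
  · rintro U L v ⟨T, hZT, hmin, hL, hLT, rfl⟩
    obtain ⟨T', X, hZT', hTX, hXT', hmin', hCC, hvC, hT'C⟩ := exists_next_separator hW hZ T hZT v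
    have hTT' : Disjoint (T : Set V) (endSide G W T') :=
      hXT'.mono_left (by exact_mod_cast hTX)
    let e := T.equivFin.symm
    have hTmem : ∀ i, (e i : V) ∈ T := fun i => (e i).2
    obtain ⟨b, q, hb, hq, hqd, -⟩ := menger_avoiding (G := G) (n := T.card)
      (L := fun i => (e i : V)) (B := T') (X := ∅) (by simp) (by
        intro S hS
        have hns : ¬ Disjoint (T : Set V) (endSide G W S) := fun h =>
          absurd (hmin S h) (by omega)
        obtain ⟨t, htT, htS⟩ := Set.not_disjoint_iff.1 hns
        obtain ⟨m, hm, hmT'⟩ := (Filter.Eventually.and htS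
          (eventually_mem_endSide hW.2 hW.2 (rayEquiv_self hW) T'.finite_toSet)).exists
        by_contra hcon
        push Not at hcon
        refine Set.disjoint_left.1 hTT' htT (hm.symm.induct
          (P := fun x => x ∈ endSide G W T') hmT' ?_)
        intro u x hu hu' hux hxS
        refine endSide_adj hu' hux fun hxT' => ?_
        refine hcon (e.symm ⟨t, htT⟩) x hxT' ?_
        simpa using hm.trans (hu.step hux hxS))
    have hidx : ∀ i, ∃ j, (e j : V) = L i := fun i => ⟨e.symm ⟨L i, (hLT i).1⟩, by simp⟩
    choose ι hι using hidx
    have hιi : Function.Injective ι := fun i j hij => hL (by rw [← hι, hij, hι])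
    have hqT : ∀ j, ∀ x ∈ (q j).support, x ∈ T → x = e j := by
      intro j x hx hxT
      obtain ⟨j', rfl⟩ : ∃ j', (e j' : V) = x := ⟨e.symm ⟨x, hxT⟩, by simp⟩
      by_contra hne
      exact hqd j j' (fun h => hne (by rw [h])) _ hx (by simp)
    have htrim := fun i => exists_path_to_first (q (ι i)) T' (hb (ι i))
    choose c r hr hcT' hrq hrc using htrim
    have hcsupp : ∀ i, c i ∈ (q (ι i)).support := fun i => hrq i (by simp)
    have hcZ : ∀ i, c i ∉ Z := by
      intro i hcZ
      refine (hLT i).2 ?_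
      rw [← hι, ← hqT (ι i) _ (hcsupp i) (hZT hcZ)]
      exact hcZ
    have hcC : ∀ i, c i ∈ endSide G W T := fun i => hT'C _ (hcT' i) (hcZ i)
    refine ⟨(endSide G W T')ᶜ, c, ⟨T', hZT', ?_, ?_, fun i => ⟨hcT' i, hcZ i⟩, rfl⟩, ?_, ?_,
      fun i => (r i).copy (hι i) rfl, ?_, ?_, ?_⟩
    · exact fun T'' hT'' => hmin' T'' (hXT'.mono_right (endSide_subset_of_disjoint hT''))
    · intro i j hij
      by_contra hne
      exact hqd _ _ (hιi.ne hne) _ (hcsupp i) (hij ▸ hcsupp j)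
    · rintro x (rfl | hx)
      · exact hvC
      · exact fun h => hx (hCC h)
    · intro i h
      exact endSide_notMem (hcC i) (h ▸ (hLT i).1)
    · exact fun i => by simpa using hr i
    · intro i j hij x hx hx'
      simp only [Walk.support_copy] at hx hx'
      exact hqd _ _ (hιi.ne hij) x (hrq i hx) (hrq j hx')
    · intro i y hy hyL
      simp only [Walk.support_copy] at hy
      rw [← hι] at hyL
      have hyT : y ∈ endSide G W T := by
        refine endSide_reach (hcC i) (AvoidReach.of_dropUntil (hr i) hy hyL ?_).symm
        exact fun x hx hxL hxT => hxL (hqT _ x (hrq i hx) hxT)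
      refine ⟨fun hyT' => ?_, fun h => h hyT, fun S hS => ?_⟩
      · by_cases hyc : y = c i
        · exact endSide_notMem hyT' (hyc ▸ hcT' i)
        · have h1 := AvoidReach.of_takeUntil (S := T') (hr i) hy hyc
            fun x hx hxc hxT' => hxc (hrc i x hx hxT')
          exact Set.disjoint_left.1 hTT' (hTmem (ι i)) (endSide_reach hyT' h1.symm)
      · exact endSide_subset_of_disjoint (Set.disjoint_left.2 fun x hx => hS hx) hyT

/-- A sequence of separators of bounded size converging to an end, modulo the set `Z`. -/
structure SepSeq (G : SimpleGraph V) (Z : Finset V) (K : ℕ) (T : ℕ → Finset V)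
    (C : ℕ → Set V) : Prop where
  card_le : ∀ j, (T j).card ≤ K
  notMem_of_sep : ∀ j, ∀ v ∈ T j, v ∉ Z ∧ v ∉ C j
  notMem_of_side : ∀ j, ∀ v ∈ C j, v ∉ Z
  adj : ∀ j x y, G.Adj x y → x ∈ C j → y ∈ C j ∨ y ∈ T j ∨ y ∈ Z
  sep_succ : ∀ j, ∀ v ∈ T (j + 1), v ∈ C j
  side_succ : ∀ j, C (j + 1) ⊆ C j
  exhaust : ∀ v, v ∉ Z → ∃ j, v ∉ C j ∧ v ∉ T j

lemma exists_sepSeq [Countable V] (hW : IsRay G W) (hn : ¬ HasDisjointRays G W n) :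
    ∃ Z K T C, SepSeq G Z K T C ∧ ∀ r : ℕ → V, IsRay G r → RayEquiv G W r →
      ∀ j, ∀ᶠ n in Filter.atTop, r n ∈ C j := by
  classical
  have hZfin : (endDom G W).Finite := by
    by_contra h
    exact hn (hasDisjointRays_of_infinite_endDom hW h)
  obtain ⟨Z, hZ⟩ := hZfin.exists_finset_coe
  have hbd : ∀ X : Finset V, ∃ T : Finset V, Disjoint (X : Set V) (endSide G W T) ∧
      T.card ≤ Z.card + n := by
    intro X
    by_contra hcon
    push Not at hcon
    exact hn (hasDisjointRays_of_large_separators hW hZ X fun T hT => (hcon T hT).le)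
  have hstep : ∀ (T : {T : Finset V // Z ⊆ T ∧ T.card ≤ Z.card + n}) (v : V),
      ∃ T' : {T : Finset V // Z ⊆ T ∧ T.card ≤ Z.card + n},
        endSide G W T'.1 ⊆ endSide G W T.1 ∧ v ∉ endSide G W T'.1 ∧
        ∀ t ∈ T'.1, t ∉ Z → t ∈ endSide G W T.1 := by
    rintro ⟨T, hZT, -⟩ v
    obtain ⟨T', X, h1, -, -, h2, h3⟩ := exists_next_separator hW hZ T hZT v
    obtain ⟨T'', h4, h5⟩ := hbd X
    exact ⟨⟨T', h1, (h2 T'' h4).trans h5⟩, h3⟩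
  choose nx hnx using hstep
  have : Nonempty V := ⟨W 0⟩
  obtain ⟨e, he⟩ := exists_surjective_nat V
  let st : ℕ → {T : Finset V // Z ⊆ T ∧ T.card ≤ Z.card + n} :=
    fun m => Nat.rec ⟨Z, le_rfl, by omega⟩ (fun m s => nx s (e m)) m
  obtain ⟨T, hT⟩ : ∃ T : ℕ → Finset V, ∀ m, T m = (st m).1 := ⟨_, fun _ => rfl⟩
  have hst : ∀ m, endSide G W (T (m + 1)) ⊆ endSide G W (T m) ∧
      e m ∉ endSide G W (T (m + 1)) ∧ ∀ t ∈ T (m + 1), t ∉ Z → t ∈ endSide G W (T m) := by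
    intro m
    rw [hT, hT]
    exact hnx (st m) (e m)
  have hZT : ∀ m, Z ⊆ T m := fun m => by rw [hT]; exact (st m).2.1
  have hTK : ∀ m, (T m).card ≤ Z.card + n := fun m => by rw [hT]; exact (st m).2.2
  refine ⟨Z, Z.card + n, fun j => T j \ Z, fun j => endSide G W (T j), ⟨?_, ?_, ?_, ?_, ?_, ?_, ?_⟩,
    fun r hr hWr j => eventually_mem_endSide hW.2 hr.2 hWr (T j).finite_toSet⟩
  · exact fun j => (Finset.card_le_card Finset.sdiff_subset).trans (hTK j)
  · intro j v hv
    rw [Finset.mem_sdiff] at hv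
    exact ⟨hv.2, fun h => endSide_notMem h hv.1⟩
  · exact fun j v hv hvZ => endSide_notMem hv (hZT j hvZ)
  · intro j x y hxy hx
    by_cases hy : y ∈ T j
    · by_cases hyZ : y ∈ Z
      · exact .inr (.inr hyZ)
      · exact .inr (.inl (by simp [hy, hyZ]))
    · exact .inl (endSide_adj hx hxy hy)
  · intro j v hv
    rw [Finset.mem_sdiff] at hv
    exact (hst j).2.2 v hv.1 hv.2
  · exact fun j => (hst j).1
  · intro v hvZ
    obtain ⟨j, rfl⟩ := he v
    refine ⟨j + 2, fun h => (hst j).2.1 ((hst (j + 1)).1 h), fun h => ?_⟩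
    rw [Finset.mem_sdiff] at h
    exact (hst j).2.1 ((hst (j + 1)).2.2 _ h.1 h.2)

end thin

section SepSeq

variable {G : SimpleGraph V} {Z : Finset V} {K : ℕ} {T : ℕ → Finset V} {C : ℕ → Set V}

namespace SepSeq

lemma side_antitone (h : SepSeq G Z K T C) : Antitone C := antitone_nat_of_succ_le h.side_succ

lemma sep_subset (h : SepSeq G Z K T C) {i j : ℕ} (hij : i < j) {v : V} (hv : v ∈ T j) :
    v ∈ C i := by
  obtain ⟨j, rfl⟩ : ∃ j', j = j' + 1 := ⟨j - 1, by omega⟩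
  exact h.side_antitone (by omega) (h.sep_succ j v hv)

lemma eventually_notMem (h : SepSeq G Z K T C) {v : V} (hv : v ∉ Z) :
    ∃ i, ∀ j, i ≤ j → v ∉ C j ∧ v ∉ T j := by
  obtain ⟨i, h1, h2⟩ := h.exhaust v hv
  refine ⟨i, fun j hij => ⟨fun h' => h1 (h.side_antitone hij h'), fun h' => ?_⟩⟩
  rcases hij.eq_or_lt with rfl | hlt
  · exact h2 h'
  · exact h1 (h.sep_subset hlt h')

lemma comp (h : SepSeq G Z K T C) {φ : ℕ → ℕ} (hφ : StrictMono φ) :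
    SepSeq G Z K (fun j => T (φ j)) (fun j => C (φ j)) where
  card_le j := h.card_le _
  notMem_of_sep j := h.notMem_of_sep _
  notMem_of_side j := h.notMem_of_side _
  adj j := h.adj _
  sep_succ j _ hv := h.sep_subset (hφ (Nat.lt_succ_self j)) hv
  side_succ j := h.side_antitone (hφ (Nat.lt_succ_self j)).le
  exhaust v hv := by
    obtain ⟨i, hi⟩ := h.eventually_notMem hv
    exact ⟨i, hi _ (hφ.id_le i)⟩

/-- Labels identifying the vertices of the separators with elements of `Fin K`. -/
lemma exists_labels (h : SepSeq G Z K T C) :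
    ∃ f : ℕ → V → ℕ, ∀ j, (∀ t ∈ T j, f j t < K) ∧
      ∀ t ∈ T j, ∀ t' ∈ T j, f j t = f j t' → t = t' := by
  classical
  refine ⟨fun j t => if ht : t ∈ T j then (T j).equivFin ⟨t, ht⟩ else 0, fun j => ⟨?_, ?_⟩⟩
  · intro t ht
    simp only [ht, dif_pos]
    exact ((T j).equivFin ⟨t, ht⟩).2.trans_le (h.card_le j)
  · intro t ht t' ht' heq
    simp only [ht, ht', dif_pos] at heq
    have := (T j).equivFin.injective (Fin.ext heq)
    simpa using this

end SepSeq

/-- Two disjoint rays converging along the sides `C` and avoiding `Z`, with all their edges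
in a set `E` of edges through which they are connected. -/
structure RayPair (G : SimpleGraph V) (Z : Finset V) (C : ℕ → Set V) (D : Bool → ℕ → V)
    (E : Set (Sym2 V)) : Prop where
  inj : ∀ b b' m n, D b m = D b' n → b = b' ∧ m = n
  edge : ∀ b n, s(D b n, D b (n + 1)) ∈ E
  le : E ⊆ G.edgeSet
  notMem : ∀ b n, D b n ∉ Z
  tends : ∀ b j, ∀ᶠ n in Filter.atTop, D b n ∈ C j
  conn : ∀ b b' m n, ∃ w : G.Walk (D b m) (D b' n), ∀ e ∈ w.edges, e ∈ E

lemma IsDoubleRay.exists_walk {f : ℤ → V} (hf : IsDoubleRay G f) (a b : ℤ) :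
    ∃ w : G.Walk (f a) (f b), ∀ e ∈ w.edges, e ∈ drEdges f := by
  have key : ∀ (a : ℤ) (n : ℕ), ∃ w : G.Walk (f a) (f (a + n)), ∀ e ∈ w.edges, e ∈ drEdges f := by
    intro a n
    induction n with
    | zero => exact ⟨(Walk.nil' (f a)).copy rfl (by simp), by simp⟩
    | succ n ih =>
      obtain ⟨w, hw⟩ := ih
      refine ⟨(w.concat (hf.2 _)).copy rfl (by push_cast; ring_nf), ?_⟩
      intro e he
      simp only [Walk.edges_copy, Walk.edges_concat, List.mem_append, List.mem_singleton,
        List.concat_eq_append] at he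
      rcases he with he | rfl
      · exact hw e he
      · exact ⟨_, rfl⟩
  rcases le_total a b with h | h
  · obtain ⟨n, rfl⟩ := Int.le.dest h
    exact key a n
  · obtain ⟨n, rfl⟩ := Int.le.dest h
    obtain ⟨w, hw⟩ := key b n
    exact ⟨w.reverse, fun e he => hw e (by simpa using he)⟩

lemma IsDoubleRay.isRay_drFwd {f : ℤ → V} (hf : IsDoubleRay G f) : IsRay G (drFwd f) := by
  refine ⟨fun a b hab => by simpa using hf.1 hab, fun n => ?_⟩
  simpa [drFwd] using hf.2 n

lemma IsDoubleRay.isRay_drBwd {f : ℤ → V} (hf : IsDoubleRay G f) : IsRay G (drBwd f) := by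
  refine ⟨fun a b hab => by simpa using hf.1 hab, fun n => ?_⟩
  have := (hf.2 (-((n + 1 : ℕ) : ℤ) - 1)).symm
  simp only [drBwd]
  convert this using 2
  push_cast
  ring

lemma IsDoubleRay.exists_rayPair {f : ℤ → V} (hf : IsDoubleRay G f)
    (h₁ : ∀ j, ∀ᶠ n in Filter.atTop, drFwd f n ∈ C j)
    (h₂ : ∀ j, ∀ᶠ n in Filter.atTop, drBwd f n ∈ C j) :
    ∃ D, RayPair G Z C D (drEdges f) := by
  obtain ⟨a, ha⟩ := eventually_notMem_of_injective hf.isRay_drFwd.1 Z.finite_toSet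
  obtain ⟨b, hb⟩ := eventually_notMem_of_injective hf.isRay_drBwd.1 Z.finite_toSet
  have hval : ∀ (c : Bool) (n : ℕ), (bif c then drFwd f (a + n) else drBwd f (b + n)) =
      f (bif c then ((a + n : ℕ) : ℤ) else -((b + n : ℕ) : ℤ) - 1) := by
    intro c n
    cases c <;> rfl
  refine ⟨fun c n => bif c then drFwd f (a + n) else drBwd f (b + n), ?_, ?_, ?_, ?_, ?_, ?_⟩
  · intro c c' m n h
    simp only [hval] at h
    have := hf.1 h
    cases c <;> cases c' <;> simp at this ⊢ <;> omega
  · intro c n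
    cases c
    · refine ⟨-((b + (n + 1) : ℕ) : ℤ) - 1, ?_⟩
      rw [Sym2.eq_swap]
      simp only [cond_false, drBwd]
      congr 2
      push_cast
      ring_nf
    · exact ⟨((a + n : ℕ) : ℤ), rfl⟩
  · rintro e ⟨n, rfl⟩
    exact hf.2 n
  · intro c n
    cases c
    · simpa using hb (b + n) (by omega)
    · simpa using ha (a + n) (by omega)
  · intro c j
    cases c
    · have := (h₂ j)
      rw [← Filter.map_add_atTop_eq_nat b] at this
      simpa [add_comm] using this
    · have := (h₁ j)
      rw [← Filter.map_add_atTop_eq_nat a] at this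
      simpa [add_comm] using this
  · intro c c' m n
    have := hf.exists_walk (bif c then ((a + m : ℕ) : ℤ) else -((b + m : ℕ) : ℤ) - 1)
      (bif c' then ((a + n : ℕ) : ℤ) else -((b + n : ℕ) : ℤ) - 1)
    rwa [← hval, ← hval] at this

/-- `y` is the successor of `x` on one of the two rays. -/
def Arc (D : Bool → ℕ → V) (x y : V) : Prop := ∃ b n, D b n = x ∧ D b (n + 1) = y

/-- The trace of a pair of rays on the separator vertex `t` at a given side. -/
def traceAt (D : Bool → ℕ → V) (S : Set V) (t : V) : Prop × Prop × Prop :=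
  ((∃ b n, D b n = t), (∃ y ∈ S, Arc D t y), (∃ y ∈ S, Arc D y t))

/-- A tableau of pairwise edge-disjoint pairs of rays whose traces on the separators agree. -/
structure RayTableau (G : SimpleGraph V) (Z : Finset V) (T : ℕ → Finset V) (C : ℕ → Set V)
    (D : ℕ → ℕ → Bool → ℕ → V) (E : ℕ → ℕ → Set (Sym2 V)) : Prop where
  pair : ∀ M q, q ≤ M → RayPair G Z C (D M q) (E M q)
  disj : ∀ M q q', q ≤ M → q' ≤ M → q ≠ q' → Disjoint (E M q) (E M q')
  trace : ∀ m M M' q q', M ≤ m → M' ≤ m → q ≤ M → q' ≤ M' → ∀ t ∈ T m,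
    traceAt (D M q) (C m) t = traceAt (D M' q') (C m) t
  src : ∀ q b, D q q b 0 ∉ C q ∧ D q q b 0 ∉ T q

/-- Among arbitrarily many objects coloured with finitely many colours there are arbitrarily many
of the same colour. -/
lemma exists_colour_of_forall {α σ : Type*} [Finite σ] (c : α → σ) (P : α → Prop)
    (r : α → α → Prop) (h : ∀ n : ℕ, ∃ F : Fin n → α,
      (∀ i, P (F i)) ∧ Pairwise fun i j => r (F i) (F j)) :
    ∃ s, ∀ n : ℕ, ∃ F : Fin n → α, (∀ i, P (F i) ∧ c (F i) = s) ∧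
      Pairwise fun i j => r (F i) (F j) := by
  classical
  have := Fintype.ofFinite σ
  by_contra hcon
  push Not at hcon
  choose m hm using hcon
  set M := ∑ s, m s
  obtain ⟨F, hF, hr⟩ := h (Fintype.card σ * M + 1)
  have hne : Nonempty σ := ⟨c (F 0)⟩
  obtain ⟨s, hs⟩ := Fintype.exists_lt_card_fiber_of_mul_lt_card (fun i => c (F i)) (n := M)
    (by simp)
  obtain ⟨F', hF', hF'm⟩ := Finset.exists_subset_card_eq
    (show m s ≤ _ from (Finset.single_le_sum (f := m) (fun _ _ => Nat.zero_le _)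
      (Finset.mem_univ s)).trans hs.le)
  let e := (Finset.equivFinOfCardEq hF'm).symm
  refine hm s (fun i => F (e i)) (fun i => ⟨hF _, ?_⟩) fun i j hij => hr ?_
  · have := hF' (e i).2
    simpa using this
  · exact fun h => hij (e.injective (Subtype.ext h))

lemma RayPair.comp {D : Bool → ℕ → V} {E : Set (Sym2 V)} (h : RayPair G Z C D E) (φ : ℕ → ℕ) :
    RayPair G Z (fun j => C (φ j)) D E :=
  { h with tends := fun b j => h.tends b (φ j) }

lemma SepSeq.exists_rayTableau (h : SepSeq G Z K T C)
    (hF : ∀ n : ℕ, ∃ F : Fin n → (Bool → ℕ → V) × Set (Sym2 V),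
      (∀ i, RayPair G Z C (F i).1 (F i).2) ∧ Pairwise fun i j => Disjoint (F i).2 (F j).2) :
    ∃ T' C' D E, SepSeq G Z K T' C' ∧ RayTableau G Z T' C' D E := by
  classical
  obtain ⟨f, hf⟩ := h.exists_labels
  let lab : ℕ → (V → Prop) → Set (Fin K) := fun j p => {l | ∃ t ∈ T j, f j t = l ∧ p t}
  have hlab : ∀ p p' j, lab j p = lab j p' → ∀ t ∈ T j, (p t ↔ p' t) := by
    have aux : ∀ p p' j, lab j p = lab j p' → ∀ t ∈ T j, p t → p' t := by
      intro p p' j heq t ht hp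
      have h1 : (⟨f j t, (hf j).1 t ht⟩ : Fin K) ∈ lab j p := ⟨t, ht, rfl, hp⟩
      rw [heq] at h1
      obtain ⟨t', ht', hft, hp'⟩ := h1
      rwa [(hf j).2 t' ht' t ht hft] at hp'
    exact fun p p' j heq t ht => ⟨aux p p' j heq t ht, aux p' p j heq.symm t ht⟩
  let status : (Bool → ℕ → V) × Set (Sym2 V) → ℕ → Set (Fin K) × Set (Fin K) × Set (Fin K) :=
    fun D j => (lab j fun t => (traceAt D.1 (C j) t).1,
      lab j fun t => (traceAt D.1 (C j) t).2.1, lab j fun t => (traceAt D.1 (C j) t).2.2)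
  have hstatus : ∀ D D' j, status D j = status D' j → ∀ t ∈ T j,
      traceAt D.1 (C j) t = traceAt D'.1 (C j) t := by
    intro D D' j heq t ht
    simp only [status, Prod.mk.injEq] at heq
    obtain ⟨h1, h2, h3⟩ := heq
    refine Prod.ext ?_ (Prod.ext ?_ ?_)
    · exact propext (hlab (fun t => (traceAt D.1 (C j) t).1)
        (fun t => (traceAt D'.1 (C j) t).1) j h1 t ht)
    · exact propext (hlab (fun t => (traceAt D.1 (C j) t).2.1)
        (fun t => (traceAt D'.1 (C j) t).2.1) j h2 t ht)
    · exact propext (hlab (fun t => (traceAt D.1 (C j) t).2.2)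
        (fun t => (traceAt D'.1 (C j) t).2.2) j h3 t ht)
  have hlim : ∀ D, ∃ s, ∀ᶠ j in (Filter.hyperfilter ℕ : Filter ℕ), status D j = s := fun D =>
    Ultrafilter.eventually_exists_iff.1 (Filter.Eventually.of_forall fun j => ⟨_, rfl⟩)
  choose c hc using hlim
  obtain ⟨s, hs⟩ := exists_colour_of_forall c (fun F => RayPair G Z C F.1 F.2)
    (fun F F' => Disjoint F.2 F'.2) hF
  choose F hFP hFd using hs
  let A : ℕ → ℕ → (Bool → ℕ → V) × Set (Sym2 V) := fun M q =>
    if hq : q ≤ M then F (M + 1) ⟨q, Nat.lt_succ_of_le hq⟩ else (F 1 0)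
  have hA : ∀ M q, RayPair G Z C (A M q).1 (A M q).2 ∧ c (A M q) = s := by
    intro M q
    simp only [A]
    split_ifs
    · exact hFP _ _
    · exact hFP _ _
  have hev : ∀ m, ∀ᶠ k in (Filter.hyperfilter ℕ : Filter ℕ), ∀ M ≤ m, ∀ q ≤ M,
      status (A M q) k = s ∧ ∀ b, (A M q).1 b 0 ∉ C k ∧ (A M q).1 b 0 ∉ T k := by
    intro m
    refine (Set.finite_Iic m).eventually_all.2 fun M _ => (Set.finite_Iic M).eventually_all.2
      fun q _ => ?_
    refine ((hc (A M q)).mono fun j hj => hj.trans (hA M q).2).and (Filter.eventually_all.2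
      fun b => ?_)
    obtain ⟨i, hi⟩ := h.eventually_notMem ((hA M q).1.notMem b 0)
    exact Nat.hyperfilter_le_atTop (Filter.eventually_atTop.2 ⟨i, hi⟩)
  obtain ⟨φ, hφ, hφP⟩ := Filter.extraction_forall_of_frequently
    fun m => (hev m).frequently.filter_mono Nat.hyperfilter_le_atTop
  refine ⟨_, _, fun M q => (A M q).1, fun M q => (A M q).2, h.comp hφ, ?_, ?_, ?_, ?_⟩
  · exact fun M q _ => (hA M q).1.comp φ
  · intro M q q' hq hq' hne
    simp only [A, hq, hq', dif_pos]
    exact hFd _ fun heq => hne (by simpa using heq)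
  · intro m M M' q q' hM hM' hq hq' t ht
    exact hstatus _ _ _ ((hφP m M hM q hq).1.trans (hφP m M' hM' q' hq').1.symm) t ht
  · intro q b
    exact (hφP q q le_rfl q le_rfl).2 b

end SepSeq

section Glue

variable {G : SimpleGraph V} {Z : Finset V} {K : ℕ} {T : ℕ → Finset V} {C : ℕ → Set V}

lemma RayPair.arc_mem {D : Bool → ℕ → V} {E : Set (Sym2 V)} (h : RayPair G Z C D E) {x y : V}
    (hxy : Arc D x y) : s(x, y) ∈ E := by
  obtain ⟨b, n, rfl, rfl⟩ := hxy
  exact h.edge b n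

lemma RayPair.arc_adj {D : Bool → ℕ → V} {E : Set (Sym2 V)} (h : RayPair G Z C D E) {x y : V}
    (hxy : Arc D x y) : G.Adj x y := h.le (h.arc_mem hxy)

lemma RayPair.arc_left_unique {D : Bool → ℕ → V} {E : Set (Sym2 V)} (h : RayPair G Z C D E)
    {x x' y : V} (hx : Arc D x y) (hx' : Arc D x' y) : x = x' := by
  obtain ⟨b, n, rfl, rfl⟩ := hx
  obtain ⟨b', n', rfl, h2⟩ := hx'
  obtain ⟨rfl, h3⟩ := h.inj _ _ _ _ h2
  rw [Nat.succ_injective h3]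

lemma RayPair.arc_right_unique {D : Bool → ℕ → V} {E : Set (Sym2 V)} (h : RayPair G Z C D E)
    {x y y' : V} (hy : Arc D x y) (hy' : Arc D x y') : y = y' := by
  obtain ⟨b, n, rfl, rfl⟩ := hy
  obtain ⟨b', n', h2, rfl⟩ := hy'
  obtain ⟨rfl, rfl⟩ := h.inj _ _ _ _ h2
  rfl

lemma RayPair.arc_notMem {D : Bool → ℕ → V} {E : Set (Sym2 V)} (h : RayPair G Z C D E) {x y : V}
    (hxy : Arc D x y) : x ∉ Z ∧ y ∉ Z := by
  obtain ⟨b, n, rfl, rfl⟩ := hxy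
  exact ⟨h.notMem _ _, h.notMem _ _⟩

lemma Arc.exists_next {D : Bool → ℕ → V} {x y : V} (h : Arc D x y) : ∃ z, Arc D y z := by
  obtain ⟨b, n, rfl, rfl⟩ := h
  exact ⟨_, b, n + 1, rfl, rfl⟩

lemma SepSeq.mem_sep_of_arc (hS : SepSeq G Z K T C) {D : Bool → ℕ → V} {E : Set (Sym2 V)}
    (h : RayPair G Z C D E) {x y : V} {j : ℕ} (hxy : Arc D x y) (hx : x ∈ C j) (hy : y ∉ C j) :
    y ∈ T j := by
  rcases hS.adj j x y (h.arc_adj hxy) hx with h1 | h1 | h1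
  · exact absurd h1 hy
  · exact h1
  · exact absurd h1 (h.arc_notMem hxy).2

lemma SepSeq.mem_sep_of_arc' (hS : SepSeq G Z K T C) {D : Bool → ℕ → V} {E : Set (Sym2 V)}
    (h : RayPair G Z C D E) {x y : V} {j : ℕ} (hxy : Arc D x y) (hx : x ∉ C j) (hy : y ∈ C j) :
    x ∈ T j := by
  rcases hS.adj j y x (h.arc_adj hxy).symm hy with h1 | h1 | h1
  · exact absurd h1 hx
  · exact h1
  · exact absurd h1 (h.arc_notMem hxy).1

/-- An arc of the `q`-th pair of the `m`-th row, lying between the sides `m` and `m + 1`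
(or anywhere outside the side `m + 1` in the first row in which `q` occurs). -/
def StageArc (C : ℕ → Set V) (D : ℕ → ℕ → Bool → ℕ → V) (q m : ℕ) (x y : V) : Prop :=
  q ≤ m ∧ Arc (D m q) x y ∧ (m = q ∨ x ∈ C m ∨ y ∈ C m) ∧ x ∉ C (m + 1) ∧ y ∉ C (m + 1)

namespace RayTableau

variable {D : ℕ → ℕ → Bool → ℕ → V} {E : ℕ → ℕ → Set (Sym2 V)}

lemma out_transfer (h : RayTableau G Z T C D E) {m M M' q : ℕ} (hM : M ≤ m) (hM' : M' ≤ m)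
    (hq : q ≤ M) (hq' : q ≤ M') {t y : V} (ht : t ∈ T m) (hy : y ∈ C m) (hty : Arc (D M q) t y) :
    ∃ y ∈ C m, Arc (D M' q) t y := by
  have := h.trace m M M' q q hM hM' hq hq' t ht
  simp only [traceAt, Prod.mk.injEq] at this
  exact this.2.1.mp ⟨y, hy, hty⟩

lemma in_transfer (h : RayTableau G Z T C D E) {m M M' q : ℕ} (hM : M ≤ m) (hM' : M' ≤ m)
    (hq : q ≤ M) (hq' : q ≤ M') {t y : V} (ht : t ∈ T m) (hy : y ∈ C m) (hty : Arc (D M q) y t) :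
    ∃ y ∈ C m, Arc (D M' q) y t := by
  have := h.trace m M M' q q hM hM' hq hq' t ht
  simp only [traceAt, Prod.mk.injEq] at this
  exact this.2.2.mp ⟨y, hy, hty⟩

lemma stageArc_unique_aux (h : RayTableau G Z T C D E) (hS : SepSeq G Z K T C) {q m m' : ℕ}
    {x x' y : V} (hx : StageArc C D q m x y) (hx' : StageArc C D q m' x' y) : m' ≤ m := by
  by_contra! hlt
  obtain ⟨hqm, ha, -, hxm, hym⟩ := hx
  obtain ⟨hqm', ha', hab, -, -⟩ := hx'
  have hym' : y ∉ C m' := fun h' => hym (hS.side_antitone hlt h')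
  have hx' : x' ∈ C m' := by
    rcases hab with h1 | h1 | h1
    · omega
    · exact h1
    · exact absurd h1 hym'
  have hyT := hS.mem_sep_of_arc (h.pair m' q hqm') ha' hx' hym'
  obtain rfl : m' = m + 1 := by
    by_contra hne
    exact hym (hS.sep_subset (by omega) hyT)
  obtain ⟨x'', hx'', ha''⟩ :=
    h.in_transfer (M' := m) le_rfl (Nat.le_succ m) hqm' hqm hyT hx' ha'
  rw [(h.pair m q hqm).arc_left_unique ha ha''] at hxm
  exact hxm hx''

lemma stageArc_unique (h : RayTableau G Z T C D E) (hS : SepSeq G Z K T C) {q m m' : ℕ}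
    {x x' y : V} (hx : StageArc C D q m x y) (hx' : StageArc C D q m' x' y) : x = x' := by
  obtain rfl : m = m' :=
    le_antisymm (h.stageArc_unique_aux hS hx' hx) (h.stageArc_unique_aux hS hx hx')
  exact (h.pair m q hx.1).arc_left_unique hx.2.1 hx'.2.1

lemma stageArc_next (h : RayTableau G Z T C D E) (hS : SepSeq G Z K T C) {q m : ℕ}
    {x y : V} (hx : StageArc C D q m x y) : ∃ z m', StageArc C D q m' y z := by
  obtain ⟨hqm, ha, hab, hxm, hym⟩ := hx
  obtain ⟨z, hz⟩ := ha.exists_next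
  by_cases hzm : z ∈ C (m + 1)
  · have hyT := hS.mem_sep_of_arc' (h.pair m q hqm) hz hym hzm
    obtain ⟨z', hz', ha'⟩ :=
      h.out_transfer (M' := m + 1) (Nat.le_succ m) le_rfl hqm (by omega) hyT hzm hz
    have hy2 : y ∉ C (m + 1 + 1) := fun h' => hym (hS.side_succ _ h')
    refine ⟨z', m + 1, by omega, ha', Or.inr (Or.inr hz'), hy2, fun h' => hym ?_⟩
    exact hS.sep_succ _ _ (hS.mem_sep_of_arc' (h.pair (m + 1) q (by omega)) ha' hy2 h')
  by_cases hb : m = q ∨ y ∈ C m ∨ z ∈ C m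
  · exact ⟨z, m, hqm, hz, hb, hym, hzm⟩
  push Not at hb
  obtain ⟨hmq, hyC, hzC⟩ := hb
  have hxC : x ∈ C m := by tauto
  have hyT := hS.mem_sep_of_arc (h.pair m q hqm) ha hxC hyC
  obtain ⟨m, rfl⟩ : ∃ m', m = m' + 1 := ⟨m - 1, by omega⟩
  obtain ⟨x', -, ha'⟩ :=
    h.in_transfer (M' := m) le_rfl (Nat.le_succ m) hqm (by omega) hyT hxC ha
  obtain ⟨z', hz'⟩ := ha'.exists_next
  refine ⟨z', m, by omega, hz', Or.inr (Or.inl (hS.sep_succ _ _ hyT)), hyC, fun h' => hzC ?_⟩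
  obtain ⟨z'', hz'', ha''⟩ :=
    h.out_transfer (M' := m + 1) (Nat.le_succ m) le_rfl (by omega) hqm hyT h' hz'
  rwa [(h.pair _ q hqm).arc_right_unique hz ha'']

lemma stageArc_source (h : RayTableau G Z T C D E) (hS : SepSeq G Z K T C) (q : ℕ) (b : Bool) :
    StageArc C D q q (D q q b 0) (D q q b 1) := by
  have ha : Arc (D q q) (D q q b 0) (D q q b 1) := ⟨b, 0, rfl, rfl⟩
  have h0 : D q q b 0 ∉ C (q + 1) := fun h' => (h.src q b).1 (hS.side_succ _ h')
  refine ⟨le_rfl, ha, Or.inl rfl, h0, fun h' => (h.src q b).1 ?_⟩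
  exact hS.sep_succ _ _ (hS.mem_sep_of_arc' (h.pair q q le_rfl) ha h0 h')

lemma not_stageArc_source (h : RayTableau G Z T C D E) (hS : SepSeq G Z K T C) {q m : ℕ} {b : Bool}
    {x : V} (hx : StageArc C D q m x (D q q b 0)) : False := by
  obtain ⟨hqm, ha, hab, -, -⟩ := hx
  rcases hqm.eq_or_lt with rfl | hlt
  · obtain ⟨b', n, -, h2⟩ := ha
    exact absurd ((h.pair _ _ le_rfl).inj _ _ _ _ h2).2 (by omega)
  · have h0 : D q q b 0 ∉ C m := fun h' => (h.src q b).1 (hS.side_antitone hlt.le h')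
    have hxC : x ∈ C m := by
      rcases hab with h1 | h1 | h1
      · omega
      · exact h1
      · exact absurd h1 h0
    exact (h.src q b).1 (hS.sep_subset hlt (hS.mem_sep_of_arc (h.pair m q hqm) ha hxC h0))

lemma finite_notMem_side (h : RayTableau G Z T C D E) {m q : ℕ} (hq : q ≤ m) (j : ℕ) :
    {v | (∃ b n, D m q b n = v) ∧ v ∉ C j}.Finite := by
  have h1 : ∀ b, ∃ N, ∀ n, N ≤ n → D m q b n ∈ C j := fun b =>
    Filter.eventually_atTop.1 ((h.pair m q hq).tends b j)
  choose N hN using h1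
  refine (Set.finite_iUnion fun b => (Set.finite_Iio (N b)).image (D m q b)).subset ?_
  rintro v ⟨⟨b, n, rfl⟩, hv⟩
  exact Set.mem_iUnion.2 ⟨b, n, not_le.1 fun h' => hv (hN b n h'), rfl⟩

lemma exists_glued_rays (h : RayTableau G Z T C D E) (hS : SepSeq G Z K T C) (q : ℕ) :
    ∃ (ρ : Bool → ℕ → V) (ν : Bool → ℕ → ℕ),
      (∀ b b' m n, ρ b m = ρ b' n → b = b' ∧ m = n) ∧
      (∀ b n, ∃ m, q < m ∧ StageArc C D q m (ρ b n) (ρ b (n + 1))) ∧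
      ∀ b N, ∀ᶠ m in Filter.atTop, N ≤ ν b m ∧ ρ b (ν b m) ∈ T m ∧
        (traceAt (D m q) (C m) (ρ b (ν b m))).1 := by
  classical
  obtain ⟨ρ, h0, harc, hinj⟩ := exists_disjoint_orbits (ι := Bool)
    (B := fun x y => ∃ m, StageArc C D q m x y) (s := fun b => D q q b 0)
    (fun x x' y ⟨m, hx⟩ ⟨m', hx'⟩ => h.stageArc_unique hS hx hx')
    (fun x y ⟨m, hx⟩ => h.stageArc_next hS hx)
    (fun b b' hb => ((h.pair q q le_rfl).inj _ _ _ _ hb).1)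
    (fun b => ⟨_, q, h.stageArc_source hS q b⟩)
    (fun b x ⟨m, hx⟩ => h.not_stageArc_source hS hx)
  have hinj' : ∀ b, Function.Injective (ρ b) := fun b m n hmn => (hinj _ _ _ _ hmn).2
  have hZ : ∀ b n, ρ b n ∉ Z := by
    intro b n
    obtain ⟨m, hm⟩ := harc b n
    exact ((h.pair m q hm.1).arc_notMem hm.2.1).1
  have hreach : ∀ m, q < m → ∀ b, ∃ n, ρ b n ∈ C m := by
    intro m hqm b
    by_contra! hcon
    have hfin : (⋃ m' ∈ Set.Icc q m, {v | (∃ b n, D m' q b n = v) ∧ v ∉ C m}).Finite :=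
      (Set.finite_Icc q m).biUnion fun m' hm' => h.finite_notMem_side hm'.1 m
    obtain ⟨N, hN⟩ := eventually_notMem_of_injective (hinj' b) hfin
    obtain ⟨m', hqm', ⟨b', n', h1, -⟩, hab, -, -⟩ := harc b N
    refine hN N le_rfl (Set.mem_biUnion (x := m') ⟨hqm', ?_⟩ ⟨⟨b', n', h1⟩, hcon N⟩)
    by_contra! hlt
    rcases hab with h2 | h2 | h2
    · omega
    · exact hcon _ (hS.side_antitone hlt.le h2)
    · exact hcon _ (hS.side_antitone hlt.le h2)
  have hhit : ∀ m, q < m → ∀ b, ∃ n, ρ b n ∈ T m ∧ (traceAt (D m q) (C m) (ρ b n)).1 := by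
    intro m hqm b
    have hex := hreach m hqm b
    obtain ⟨n, hn⟩ : ∃ n, Nat.find hex = n + 1 := by
      refine ⟨Nat.find hex - 1, ?_⟩
      have : Nat.find hex ≠ 0 := by
        intro heq
        have := Nat.find_spec hex
        rw [heq, h0] at this
        exact (h.src q b).1 (hS.side_antitone hqm.le this)
      omega
    have h1 : ρ b (n + 1) ∈ C m := hn ▸ Nat.find_spec hex
    have h2 : ρ b n ∉ C m := Nat.find_min hex (by omega)
    obtain ⟨m', hqm', ha, hab, -, h4⟩ := harc b n
    have hle : m ≤ m' := by
      by_contra! hlt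
      exact h4 (hS.side_antitone hlt h1)
    have h5 := hS.mem_sep_of_arc' (h.pair m' q hqm') ha h2 h1
    obtain rfl : m = m' := by
      by_contra hne
      have h6 : ρ b n ∉ C m' := fun h' => h2 (hS.side_antitone hle h')
      have h7 : ρ b (n + 1) ∈ C m' := by
        rcases hab with h7 | h7 | h7
        · omega
        · exact absurd h7 h6
        · exact h7
      exact h2 (hS.sep_subset (by omega) (hS.mem_sep_of_arc' (h.pair m' q hqm') ha h6 h7))
    obtain ⟨b', n', h6, -⟩ := ha
    exact ⟨n, h5, b', n', h6⟩
  have hlate : ∀ b, ∃ N, ∀ n, N ≤ n → ∃ m, q < m ∧ StageArc C D q m (ρ b n) (ρ b (n + 1)) := by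
    intro b
    obtain ⟨N, hN⟩ := eventually_notMem_of_injective (hinj' b)
      (h.finite_notMem_side (le_refl q) (q + 1))
    refine ⟨N, fun n hn => ?_⟩
    obtain ⟨m, hm⟩ := harc b n
    refine ⟨m, lt_of_le_of_ne hm.1 ?_, hm⟩
    rintro rfl
    obtain ⟨b', n', h6, -⟩ := hm.2.1
    exact hN n hn ⟨⟨b', n', h6⟩, hm.2.2.2.1⟩
  choose M hM using hlate
  have hν : ∀ b m, ∃ n, q < m → ρ b n ∈ T m ∧ (traceAt (D m q) (C m) (ρ b n)).1 := by
    intro b m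
    by_cases hqm : q < m
    · obtain ⟨n, hn⟩ := hhit m hqm b
      exact ⟨n, fun _ => hn⟩
    · exact ⟨0, fun h' => absurd h' hqm⟩
  choose ν hν using hν
  have hνlarge : ∀ b N, ∀ᶠ m in Filter.atTop, N ≤ ν b m := by
    intro b N
    have h1 : ∀ᶠ m in Filter.atTop, ∀ n < N, ρ b n ∉ T m := by
      refine (Set.finite_Iio N).eventually_all.2 fun n _ => ?_
      obtain ⟨i, hi⟩ := hS.eventually_notMem (hZ b n)
      exact Filter.eventually_atTop.2 ⟨i, fun j hj => (hi j hj).2⟩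
    filter_upwards [h1, Filter.eventually_gt_atTop q] with m hm hqm
    by_contra! hlt
    exact hm _ hlt (hν b m hqm).1
  refine ⟨fun b n => ρ b (M b + n), fun b m => ν b m - M b, ?_, ?_, ?_⟩
  · intro b b' m n hmn
    obtain ⟨rfl, h2⟩ := hinj _ _ _ _ hmn
    exact ⟨rfl, by omega⟩
  · exact fun b n => hM b (M b + n) (by omega)
  · intro b N
    filter_upwards [hνlarge b (M b + N), Filter.eventually_gt_atTop q] with m hm hqm
    have : M b + (ν b m - M b) = ν b m := by omega
    rw [this]
    exact ⟨by omega, hν b m hqm⟩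

end RayTableau

end Glue

section RaySystem

/-- Infinitely many edge-disjoint pairs of disjoint rays such that any two of the first rays and
any two of the second rays meet infinitely often, and the two rays of each pair cannot be separated
by finitely many edges. -/
structure RaySystem (G : SimpleGraph V) (ρ : ℕ → Bool → ℕ → V) : Prop where
  inj : ∀ q b b' m n, ρ q b m = ρ q b' n → b = b' ∧ m = n
  adj : ∀ q b n, G.Adj (ρ q b n) (ρ q b (n + 1))
  disj : ∀ q p, q ≠ p → ∀ b b' m n,
    s(ρ q b m, ρ q b (m + 1)) ≠ s(ρ p b' n, ρ p b' (n + 1))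
  meet : ∀ q p b N N', ∃ n n', N ≤ n ∧ N' ≤ n' ∧ ρ q b n = ρ p b n'
  conn : ∀ q (E : Finset (Sym2 V)) N, ∃ n n', N ≤ n ∧ N ≤ n' ∧
    ∃ w : G.Walk (ρ q true n) (ρ q false n'), ∀ e ∈ w.edges, e ∉ E

lemma exists_disjoint_finset {α : Type*} {m : ℕ} (A : ℕ → Set α) (E : Finset α)
    (hE : E.card ≤ m)
    (hA : ∀ i j, i ≤ m → j ≤ m → i ≠ j → Disjoint (A i) (A j)) :
    ∃ i ≤ m, ∀ e ∈ E, e ∉ A i := by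
  by_contra! hcon
  have : Nonempty α := ⟨(hcon 0 m.zero_le).choose⟩
  choose! f hf using hcon
  obtain ⟨i, hi, j, hj, hij, heq⟩ := Finset.exists_ne_map_eq_of_card_lt_of_maps_to
    (s := Finset.range (m + 1)) (t := E) (by simpa using Nat.lt_succ_of_le hE) (f := f)
    fun i hi => (hf i (by simpa [Nat.lt_succ_iff] using hi)).1
  simp only [Finset.mem_range, Nat.lt_succ_iff] at hi hj
  exact Set.disjoint_left.1 (hA i j hi hj hij) (hf i hi).2 (heq ▸ (hf j hj).2)

variable {G : SimpleGraph V} {Z : Finset V} {K : ℕ} {T : ℕ → Finset V} {C : ℕ → Set V}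

lemma RayTableau.exists_raySystem {D : ℕ → ℕ → Bool → ℕ → V} {E : ℕ → ℕ → Set (Sym2 V)}
    (h : RayTableau G Z T C D E) (hS : SepSeq G Z K T C) : ∃ ρ, RaySystem G ρ := by
  classical
  choose ρ ν hinj harc hν using h.exists_glued_rays hS
  obtain ⟨f, hf⟩ := hS.exists_labels
  have hlim : ∀ q b, ∃ l : Fin K, ∀ᶠ m in (Filter.hyperfilter ℕ : Filter ℕ),
      f m (ρ q b (ν q b m)) = l := by
    intro q b
    refine Ultrafilter.eventually_exists_iff.1 ?_
    filter_upwards [Nat.hyperfilter_le_atTop (hν q b 0)] with m hm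
    exact ⟨⟨_, (hf m).1 _ hm.2.1⟩, rfl⟩
  choose l hl using hlim
  obtain ⟨s, hs⟩ := Finite.exists_infinite_fiber l
  let φ := Set.Infinite.natEmbedding _ (Set.infinite_coe_iff.1 hs)
  have hφ : ∀ q, l (φ q) = s := fun q => (φ q).2
  have hmemE : ∀ q b n, ∃ m, q < m ∧ StageArc C D q m (ρ q b n) (ρ q b (n + 1)) ∧
      s(ρ q b n, ρ q b (n + 1)) ∈ E m q := by
    intro q b n
    obtain ⟨m, hqm, hm⟩ := harc q b n
    exact ⟨m, hqm, hm, (h.pair m q hm.1).arc_mem hm.2.1⟩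
  have hlt : ∀ q p b b' n n' m m', p < m' → m < m' →
      StageArc C D q m (ρ q b n) (ρ q b (n + 1)) →
      StageArc C D p m' (ρ p b' n') (ρ p b' (n' + 1)) →
      s(ρ q b n, ρ q b (n + 1)) ≠ s(ρ p b' n', ρ p b' (n' + 1)) := by
    intro q p b b' n n' m m' hp hmm h1 h2 heq
    obtain ⟨-, -, -, h3, h4⟩ := h1
    obtain ⟨-, -, h5, -, -⟩ := h2
    have h6 : ∀ v, v ∈ C m' → v ∈ C (m + 1) := fun v hv => hS.side_antitone hmm hv
    have h7 : ∀ v ∈ s(ρ q b n, ρ q b (n + 1)), v ∉ C (m + 1) := by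
      intro v hv
      rcases Sym2.mem_iff.1 hv with rfl | rfl
      · exact h3
      · exact h4
    rw [heq] at h7
    rcases h5 with h5 | h5 | h5
    · omega
    · exact h7 _ (Sym2.mem_mk_left _ _) (h6 _ h5)
    · exact h7 _ (Sym2.mem_mk_right _ _) (h6 _ h5)
  refine ⟨fun q => ρ (φ q), fun q => hinj _, ?_, ?_, ?_, ?_⟩
  · intro q b n
    obtain ⟨m, -, hm⟩ := harc (φ q) b n
    exact (h.pair m _ hm.1).arc_adj hm.2.1
  · intro q p hqp b b' m n heq
    obtain ⟨i, hi, hi', hi''⟩ := hmemE (φ q) b m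
    obtain ⟨j, hj, hj', hj''⟩ := hmemE (φ p) b' n
    rcases lt_trichotomy i j with hij | rfl | hij
    · exact hlt _ _ _ _ _ _ _ _ hj hij hi' hj' heq
    · refine Set.disjoint_left.1 (h.disj i (φ q) (φ p) hi.le hj.le ?_) hi'' (heq ▸ hj'')
      exact fun h' => hqp (φ.injective (Subtype.ext h'))
    · exact hlt _ _ _ _ _ _ _ _ hi hij hj' hi' heq.symm
  · intro q p b N N'
    have h1 := hl (φ q) b
    have h2 := hl (φ p) b
    rw [hφ] at h1 h2
    have h3 := ((hν (φ q) b N).and (hν (φ p) b N')).filter_mono Nat.hyperfilter_le_atTop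
    obtain ⟨m, hm1, hm2, hm3, hm4⟩ := (h1.and (h2.and h3)).exists
    exact ⟨_, _, hm3.1, hm4.1, (hf m).2 _ hm3.2.1 _ hm4.2.1 (hm1.trans hm2.symm)⟩
  · intro q E' N
    obtain ⟨m, ⟨h1, h2⟩, h3, h4⟩ := ((hν (φ q) true N).and (hν (φ q) false N)).and
      ((Filter.eventually_ge_atTop (φ q : ℕ)).and (Filter.eventually_ge_atTop E'.card)) |>.exists
    obtain ⟨i, him, hi⟩ := exists_disjoint_finset (E m) E' h4 (h.disj m)
    have key : ∀ t ∈ T m, (traceAt (D m (φ q)) (C m) t).1 → ∃ b n, D m i b n = t := by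
      intro t ht h5
      rw [h.trace m m m (φ q) i le_rfl le_rfl h3 him t ht] at h5
      exact h5
    obtain ⟨b, n, h5⟩ := key _ h1.2.1 h1.2.2
    obtain ⟨b', n', h6⟩ := key _ h2.2.1 h2.2.2
    refine ⟨_, _, h1.1, h2.1, ?_⟩
    obtain ⟨w, hw⟩ := (h.pair m i him).conn b b' n n'
    rw [← h5, ← h6]
    exact ⟨w, fun e he he' => hi e he' (hw e he)⟩

end RaySystem

section Connectors

/-- A path between two sets that meets each of them only in an end vertex. -/
lemma exists_path_between {H : SimpleGraph V} {A B : Set V} {a b : V} (ha : a ∈ A) (hb : b ∈ B)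
    (hab : H.Reachable a b) : ∃ a' ∈ A, ∃ b' ∈ B, ∃ p : H.Walk a' b', p.IsPath ∧
      ∀ x ∈ p.support, (x ∈ A → x = a') ∧ (x ∈ B → x = b') := by
  obtain ⟨w⟩ := hab
  obtain ⟨b', p, hp, hb', -, hpB⟩ := exists_path_to_first w B hb
  obtain ⟨a', p', hp', ha', hsub, hpA⟩ := exists_path_to_first p.reverse A ha
  refine ⟨a', ha', b', hb', p'.reverse, hp'.reverse, fun x hx => ?_⟩
  rw [Walk.support_reverse, List.mem_reverse] at hx
  have := hsub hx
  rw [Walk.support_reverse, List.mem_reverse] at this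
  exact ⟨hpA x hx, hpB x this⟩

lemma reachable_along {H : SimpleGraph V} {r : ℕ → V} {m n : ℕ} (hmn : m ≤ n)
    (h : ∀ i, m ≤ i → i < n → H.Adj (r i) (r (i + 1))) : H.Reachable (r m) (r n) := by
  induction n, hmn using Nat.le_induction with
  | base => rfl
  | succ n hmn ih =>
    exact (ih fun i h1 h2 => h i h1 (by omega)).trans (h n hmn (by omega)).reachable

lemma exists_isDoubleRay_of_rays {H : SimpleGraph V} {ρ : Bool → ℕ → V}
    (hinj : ∀ b b' m n, ρ b m = ρ b' n → b = b' ∧ m = n)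
    (hadj : ∀ b n, H.Adj (ρ b n) (ρ b (n + 1))) (hconn : H.Reachable (ρ true 0) (ρ false 0)) :
    ∃ f, IsDoubleRay H f := by
  obtain ⟨-, ⟨s, rfl⟩, -, ⟨t, rfl⟩, p, hp, hpx⟩ := exists_path_between
    (A := Set.range (ρ true)) (B := Set.range (ρ false)) ⟨0, rfl⟩ ⟨0, rfl⟩ hconn
  have hL : 0 < p.length := by
    by_contra! h0
    have := Walk.eq_of_length_eq_zero (p := p) (by omega)
    simpa using (hinj _ _ _ _ this).1
  have hmid : ∀ b j n, 0 < j → j < p.length → p.getVert j ≠ ρ b n := by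
    intro b j n h1 h2 heq
    have h3 := hpx _ (p.getVert_mem_support j)
    cases b
    · have h4 := h3.2 ⟨n, heq.symm⟩
      have := hp.getVert_injOn (show j ≤ p.length by omega) (show p.length ≤ p.length from le_rfl)
        (by rw [h4, Walk.getVert_length])
      omega
    · have h4 := h3.1 ⟨n, heq.symm⟩
      have := hp.getVert_injOn (show j ≤ p.length by omega) (show 0 ≤ p.length by omega)
        (by rw [h4, Walk.getVert_zero])
      omega
  let f : ℤ → V := fun n => if n < 0 then ρ true (s + n.natAbs)
    else if n ≤ p.length then p.getVert n.toNat else ρ false (t + (n - p.length).toNat)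
  have f1 : ∀ j : ℕ, f (-j) = ρ true (s + j) := by
    intro j
    rcases Nat.eq_zero_or_pos j with rfl | hj
    · simp [f]
    · simp [f, hj]
  have f2 : ∀ j : ℕ, j ≤ p.length → f j = p.getVert j := by
    intro j hj
    simp [f, hj]
  have f3 : ∀ j : ℕ, f (p.length + j) = ρ false (t + j) := by
    intro j
    rcases Nat.eq_zero_or_pos j with rfl | hj
    · simp [f]
    · have h1 : ¬ ((p.length : ℤ) + j < 0) := by omega
      have h2 : ¬ ((p.length : ℤ) + j ≤ p.length) := by omega
      have h3 : ((p.length : ℤ) + j).toNat - p.length = j := by omega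
      simp [f, h1, hj.ne', h3]
  have cases3 : ∀ n : ℤ, (∃ j : ℕ, n = -j) ∨ (∃ j : ℕ, 0 < j ∧ j < p.length ∧ n = j) ∨
      ∃ j : ℕ, n = p.length + j := by
    intro n
    rcases le_or_gt n 0 with h | h
    · exact Or.inl ⟨n.natAbs, by omega⟩
    · rcases lt_or_ge n p.length with h' | h'
      · exact Or.inr (Or.inl ⟨n.toNat, by omega, by omega, by omega⟩)
      · exact Or.inr (Or.inr ⟨(n - p.length).toNat, by omega⟩)
  refine ⟨f, ?_, ?_⟩
  · intro m n hmn
    rcases cases3 m with ⟨i, rfl⟩ | ⟨i, hi, hi', rfl⟩ | ⟨i, rfl⟩ <;>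
    rcases cases3 n with ⟨j, rfl⟩ | ⟨j, hj, hj', rfl⟩ | ⟨j, rfl⟩
    · rw [f1, f1] at hmn
      have := (hinj _ _ _ _ hmn).2
      omega
    · rw [f1, f2 _ hj'.le] at hmn
      exact absurd hmn.symm (hmid _ _ _ hj hj')
    · rw [f1, f3] at hmn
      simpa using (hinj _ _ _ _ hmn).1
    · rw [f1, f2 _ hi'.le] at hmn
      exact absurd hmn (hmid _ _ _ hi hi')
    · rw [f2 _ hi'.le, f2 _ hj'.le] at hmn
      have := hp.getVert_injOn (show i ≤ p.length from hi'.le) (show j ≤ p.length from hj'.le) hmn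
      omega
    · rw [f3, f2 _ hi'.le] at hmn
      exact absurd hmn (hmid _ _ _ hi hi')
    · rw [f1, f3] at hmn
      simpa using (hinj _ _ _ _ hmn).1
    · rw [f3, f2 _ hj'.le] at hmn
      exact absurd hmn.symm (hmid _ _ _ hj hj')
    · rw [f3, f3] at hmn
      have := (hinj _ _ _ _ hmn).2
      omega
  · intro n
    rcases lt_or_ge n 0 with h | h
    · obtain ⟨j, rfl⟩ : ∃ j : ℕ, n = -((j + 1 : ℕ) : ℤ) := ⟨n.natAbs - 1, by omega⟩
      have : -((j + 1 : ℕ) : ℤ) + 1 = -(j : ℤ) := by push_cast; ring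
      rw [this, f1, f1]
      exact (hadj true (s + j)).symm
    · rcases lt_or_ge n p.length with h' | h'
      · obtain ⟨j, rfl⟩ := Int.eq_ofNat_of_zero_le h
        have hj : j < p.length := by omega
        have := f2 (j + 1) hj
        push_cast at this
        rw [f2 j hj.le, this]
        exact p.adj_getVert_succ hj
      · obtain ⟨j, rfl⟩ := Int.le.dest h'
        have := f3 (j + 1)
        push_cast at this
        rw [f3, add_assoc, this]
        exact hadj false (t + j)

namespace RaySystem

variable {G : SimpleGraph V} {ρ : ℕ → Bool → ℕ → V}

/-- The `n`-th edge of the ray `ρ q b`. -/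
def edgeAt (ρ : ℕ → Bool → ℕ → V) (q : ℕ) (b : Bool) (n : ℕ) : Sym2 V :=
  s(ρ q b n, ρ q b (n + 1))

lemma edgeAt_mem (h : RaySystem G ρ) (q : ℕ) (b : Bool) (n : ℕ) : edgeAt ρ q b n ∈ G.edgeSet :=
  h.adj q b n

lemma edgeAt_inj (h : RaySystem G ρ) {q p : ℕ} {b b' : Bool} {m n : ℕ}
    (heq : edgeAt ρ q b m = edgeAt ρ p b' n) : q = p ∧ b = b' ∧ m = n := by
  obtain rfl : q = p := by
    by_contra hne
    exact h.disj q p hne b b' m n heq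
  rcases Sym2.eq_iff.1 heq with ⟨h1, -⟩ | ⟨h1, h2⟩
  · exact ⟨rfl, h.inj _ _ _ _ _ h1⟩
  · have h3 := h.inj _ _ _ _ _ h1
    have h4 := h.inj _ _ _ _ _ h2
    omega

lemma tail (h : RaySystem G ρ) (N : ℕ → ℕ) : RaySystem G fun q b n => ρ q b (N q + n) where
  inj q b b' m n hmn := by
    obtain ⟨h1, h2⟩ := h.inj _ _ _ _ _ hmn
    exact ⟨h1, by omega⟩
  adj q b n := h.adj q b (N q + n)
  disj q p hqp b b' m n := h.disj q p hqp b b' _ _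
  meet q p b M M' := by
    obtain ⟨n, n', hn, hn', heq⟩ := h.meet q p b (N q + M) (N p + M')
    refine ⟨n - N q, n' - N p, by omega, by omega, ?_⟩
    rwa [Nat.add_sub_cancel' (by omega), Nat.add_sub_cancel' (by omega)]
  conn q E M := by
    obtain ⟨n, n', hn, hn', hw⟩ := h.conn q E (N q + M)
    refine ⟨n - N q, n' - N q, by omega, by omega, ?_⟩
    rwa [Nat.add_sub_cancel' (by omega), Nat.add_sub_cancel' (by omega)]

lemma exists_avoiding (h : RaySystem G ρ) (q : ℕ) {S : Set V} (hS : S.Finite) :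
    ∃ N, ∀ b n, N ≤ n → ρ q b n ∉ S := by
  have : ∀ b, ∃ N, ∀ n, N ≤ n → ρ q b n ∉ S := fun b =>
    eventually_notMem_of_injective (fun m n hmn => (h.inj _ _ _ _ _ hmn).2) hS
  choose N hN using this
  refine ⟨max (N true) (N false), fun b n hn => hN b n ?_⟩
  cases b <;> omega

lemma exists_locally_finite [Countable V] (h : RaySystem G ρ) :
    ∃ ρ', RaySystem G ρ' ∧ ∀ v, {q | ∃ b n, ρ' q b n = v}.Finite := by
  obtain ⟨g, hg⟩ := Countable.exists_injective_nat V
  have := fun q => h.exists_avoiding q ((Set.finite_Iic q).preimage hg.injOn)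
  choose N hN using this
  refine ⟨_, h.tail N, fun v => (Set.finite_Iio (g v)).subset ?_⟩
  rintro q ⟨b, n, rfl⟩
  have := hN q b (N q + n) (by omega)
  simpa using this

/-- A finite connection between a first and a second ray of the system whose set `P` of edges
contains no edge of the system. -/
structure IsConnector (G : SimpleGraph V) (ρ : ℕ → Bool → ℕ → V) (a b s t : ℕ)
    (P : Finset (Sym2 V)) : Prop where
  le : ∀ e ∈ P, e ∈ G.edgeSet
  reach : (fromEdgeSet (P : Set (Sym2 V))).Reachable (ρ a true s) (ρ b false t)
  notMem : ∀ q c n, edgeAt ρ q c n ∉ P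

lemma exists_isConnector (h : RaySystem G ρ) (hfin : ∀ v, {q | ∃ b n, ρ q b n = v}.Finite)
    (E : Finset (Sym2 V)) (B : Finset V) :
    ∃ a b s t P, IsConnector G ρ a b s t P ∧ Disjoint P E ∧ ρ a true s ∉ B ∧ ρ b false t ∉ B := by
  classical
  have hBfin : {q | ∃ b n, ρ q b n ∈ B}.Finite := by
    refine (B.finite_toSet.biUnion fun v _ => hfin v).subset ?_
    rintro q ⟨b, n, hn⟩
    exact Set.mem_biUnion (x := ρ q b n) hn ⟨b, n, rfl⟩
  have hN : ∀ q, ∃ N, (∀ b n, N ≤ n → ρ q b n ∉ B) ∧ ((∀ b n, ρ q b n ∉ B) → N = 0) := by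
    intro q
    by_cases hq : ∀ b n, ρ q b n ∉ B
    · exact ⟨0, fun b n _ => hq b n, fun _ => rfl⟩
    · obtain ⟨N, hN⟩ := h.exists_avoiding q B.finite_toSet
      exact ⟨N, hN, fun h' => absurd h' hq⟩
  choose N hNB hN0 using hN
  have hstart : {e | ∃ q b n, n < N q ∧ e = edgeAt ρ q b n}.Finite := by
    refine (hBfin.biUnion fun q _ => Set.finite_iUnion fun b =>
      (Set.finite_Iio (N q)).image (edgeAt ρ q b)).subset ?_
    rintro e ⟨q, b, n, hn, rfl⟩
    have hq : ∃ b n, ρ q b n ∈ B := by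
      by_contra! hcon
      have := hN0 q hcon
      omega
    exact Set.mem_biUnion (x := q) hq (Set.mem_iUnion.2 ⟨b, n, hn, rfl⟩)
  obtain ⟨E₀, hE₀⟩ := hstart.exists_finset_coe
  obtain ⟨n, n', hn, hn', w, hw⟩ := h.conn 0 (E ∪ E₀) (N 0)
  obtain ⟨-, ⟨a, s, hs, rfl⟩, -, ⟨b, t, ht, rfl⟩, p, hp, hpx⟩ := exists_path_between
    (H := G.deleteEdges (E ∪ E₀ : Finset (Sym2 V)))
    (A := {v | ∃ q n, N q ≤ n ∧ v = ρ q true n}) (B := {v | ∃ q n, N q ≤ n ∧ v = ρ q false n})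
    ⟨0, n, hn, rfl⟩ ⟨0, n', hn', rfl⟩ ⟨w.toDeleteEdges _ hw⟩
  have hedge : ∀ e ∈ p.edges, e ∈ G.edgeSet ∧ e ∉ E ∧ e ∉ E₀ := by
    intro e he
    have := p.edges_subset_edgeSet he
    rw [edgeSet_deleteEdges] at this
    have h2 := this.2
    simp only [Finset.coe_union, Set.mem_union, Finset.mem_coe, not_or] at h2
    exact ⟨this.1, h2⟩
  refine ⟨a, b, s, t, p.edges.toFinset, ⟨?_, ?_, ?_⟩, ?_, hNB _ _ _ hs, hNB _ _ _ ht⟩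
  · intro e he
    exact (hedge e (by simpa using he)).1
  · refine ⟨p.transfer _ fun e he => ?_⟩
    rw [edgeSet_fromEdgeSet]
    exact ⟨by simpa using he, fun hd => G.not_isDiag_of_mem_edgeSet (hedge e he).1 hd⟩
  · intro q c n hq
    have hq : edgeAt ρ q c n ∈ p.edges := by simpa using hq
    have hnN : N q ≤ n := by
      by_contra! hlt
      refine (hedge _ hq).2.2 ?_
      rw [← Finset.mem_coe, hE₀]
      exact ⟨q, c, n, hlt, rfl⟩
    have h1 := hpx _ (p.fst_mem_support_of_mem_edges hq)
    have h2 := hpx _ (p.snd_mem_support_of_mem_edges hq)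
    refine (h.adj q c n).ne ?_
    cases c
    · exact (h1.2 ⟨q, n, hnN, rfl⟩).trans (h2.2 ⟨q, n + 1, by omega, rfl⟩).symm
    · exact (h1.1 ⟨q, n, hnN, rfl⟩).trans (h2.1 ⟨q, n + 1, by omega, rfl⟩).symm
  · rw [Finset.disjoint_left]
    intro e he
    exact (hedge e (by simpa using he)).2.1

end RaySystem

end Connectors

section Assembly

namespace RaySystem

variable {G : SimpleGraph V} {ρ : ℕ → Bool → ℕ → V}

/-- The edges of the pair `ρ c`, of a connector `P` and of the segments leading from the ends of the
connector to the pair. -/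
def linkEdges (ρ : ℕ → Bool → ℕ → V) (a b s t : ℕ) (P : Finset (Sym2 V)) (c e e' : ℕ) :
    Set (Sym2 V) :=
  {d | d ∈ P ∨ (∃ x n, d = edgeAt ρ c x n) ∨ (∃ n, s ≤ n ∧ n < e ∧ d = edgeAt ρ a true n) ∨
    ∃ n, t ≤ n ∧ n < e' ∧ d = edgeAt ρ b false n}

variable {a b s t c e e' : ℕ} {P : Finset (Sym2 V)}

lemma linkEdges_subset (h : RaySystem G ρ) (hP : IsConnector G ρ a b s t P) :
    linkEdges ρ a b s t P c e e' ⊆ G.edgeSet := by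
  rintro d (hd | ⟨x, n, rfl⟩ | ⟨n, -, -, rfl⟩ | ⟨n, -, -, rfl⟩)
  · exact hP.le d hd
  all_goals exact h.edgeAt_mem _ _ _

lemma exists_isDoubleRay_linkEdges (h : RaySystem G ρ) (hP : IsConnector G ρ a b s t P)
    (hse : s ≤ e) (hte : t ≤ e') (he : ρ a true e ∈ Set.range (ρ c true))
    (he' : ρ b false e' ∈ Set.range (ρ c false)) :
    ∃ f, IsDoubleRay G f ∧ drEdges f ⊆ linkEdges ρ a b s t P c e e' := by
  set F := linkEdges ρ a b s t P c e e' with hF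
  have hadj : ∀ q x n, edgeAt ρ q x n ∈ F → (fromEdgeSet F).Adj (ρ q x n) (ρ q x (n + 1)) :=
    fun q x n hn => (fromEdgeSet_adj F).2 ⟨hn, (h.adj q x n).ne⟩
  have hray : ∀ x n, (fromEdgeSet F).Adj (ρ c x n) (ρ c x (n + 1)) := fun x n =>
    hadj _ _ _ (Or.inr (Or.inl ⟨x, n, rfl⟩))
  have h1 : (fromEdgeSet F).Reachable (ρ a true s) (ρ a true e) := reachable_along hse
    fun i hi hi' => hadj _ _ _ (Or.inr (Or.inr (Or.inl ⟨i, hi, hi', rfl⟩)))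
  have h2 : (fromEdgeSet F).Reachable (ρ b false t) (ρ b false e') := reachable_along hte
    fun i hi hi' => hadj _ _ _ (Or.inr (Or.inr (Or.inr ⟨i, hi, hi', rfl⟩)))
  have h3 : (fromEdgeSet F).Reachable (ρ a true s) (ρ b false t) :=
    hP.reach.mono (fromEdgeSet_mono fun d hd => Or.inl hd)
  obtain ⟨n, hn⟩ := he
  obtain ⟨n', hn'⟩ := he'
  have h4 : (fromEdgeSet F).Reachable (ρ c true 0) (ρ c true n) :=
    reachable_along n.zero_le fun i _ _ => hray _ i
  have h5 : (fromEdgeSet F).Reachable (ρ c false 0) (ρ c false n') :=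
    reachable_along n'.zero_le fun i _ _ => hray _ i
  rw [hn] at h4
  rw [hn'] at h5
  obtain ⟨f, hf⟩ := exists_isDoubleRay_of_rays (h.inj c) hray
    (h4.trans (h1.symm.trans (h3.trans (h2.trans h5.symm))))
  have hfF : drEdges f ⊆ F := by
    rintro d ⟨n, rfl⟩
    exact ((fromEdgeSet_adj F).1 (hf.2 n)).1
  exact ⟨f, ⟨hf.1, fun n => h.linkEdges_subset hP (hfF ⟨n, rfl⟩)⟩, hfF⟩

lemma disjoint_linkEdges (h : RaySystem G ρ) {a₁ b₁ s₁ t₁ c₁ e₁ e₁' : ℕ} {P₁ : Finset (Sym2 V)}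
    (hP : IsConnector G ρ a b s t P) (hP₁ : IsConnector G ρ a₁ b₁ s₁ t₁ P₁) (hPP : Disjoint P P₁)
    (hc : c ≠ c₁) (ha : a₁ ≠ c) (hb : b₁ ≠ c) (ha₁ : a ≠ c₁) (hb₁ : b ≠ c₁)
    (he : a₁ = a → e ≤ s₁) (he' : b₁ = b → e' ≤ t₁) :
    Disjoint (linkEdges ρ a b s t P c e e') (linkEdges ρ a₁ b₁ s₁ t₁ P₁ c₁ e₁ e₁') := by
  rw [Set.disjoint_left]
  rintro d (hd | ⟨x, n, rfl⟩ | ⟨n, hn, hn', rfl⟩ | ⟨n, hn, hn', rfl⟩)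
    (hd' | ⟨y, m, hd'⟩ | ⟨m, hm, hm', hd'⟩ | ⟨m, hm, hm', hd'⟩)
  · exact Finset.disjoint_left.1 hPP hd hd'
  iterate 3 exact hP.notMem _ _ _ (hd' ▸ hd)
  · exact hP₁.notMem _ _ _ hd'
  · exact hc (h.edgeAt_inj hd').1
  · exact ha (h.edgeAt_inj hd').1.symm
  · exact hb (h.edgeAt_inj hd').1.symm
  · exact hP₁.notMem _ _ _ hd'
  · exact ha₁ (h.edgeAt_inj hd').1
  · obtain ⟨h1, -, rfl⟩ := h.edgeAt_inj hd'
    have := he h1.symm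
    omega
  · simpa using (h.edgeAt_inj hd').2.1
  · exact hP₁.notMem _ _ _ hd'
  · exact hb₁ (h.edgeAt_inj hd').1
  · simpa using (h.edgeAt_inj hd').2.1
  · obtain ⟨h1, -, rfl⟩ := h.edgeAt_inj hd'
    have := he' h1.symm
    omega

lemma exists_seq_isConnector (h : RaySystem G ρ) (hfin : ∀ v, {q | ∃ b n, ρ q b n = v}.Finite) :
    ∃ (a b s t : ℕ → ℕ) (P : ℕ → Finset (Sym2 V)),
      (∀ i, IsConnector G ρ (a i) (b i) (s i) (t i) (P i)) ∧
      (∀ i j, i ≠ j → Disjoint (P i) (P j)) ∧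
      (Function.Injective fun i => ρ (a i) true (s i)) ∧
      Function.Injective fun i => ρ (b i) false (t i) := by
  classical
  obtain ⟨F, hF, hFr⟩ := exists_seq_of_forall_finset_exists
    (α := ℕ × ℕ × ℕ × ℕ × Finset (Sym2 V))
    (fun x => IsConnector G ρ x.1 x.2.1 x.2.2.1 x.2.2.2.1 x.2.2.2.2)
    (fun x y => Disjoint x.2.2.2.2 y.2.2.2.2 ∧
      ρ x.1 true x.2.2.1 ≠ ρ y.1 true y.2.2.1 ∧
      ρ x.2.1 false x.2.2.2.1 ≠ ρ y.2.1 false y.2.2.2.1) (by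
    intro S _
    obtain ⟨a, b, s, t, P, hP, hPE, ha, hb⟩ := h.exists_isConnector hfin
      (S.biUnion fun x => x.2.2.2.2)
      (S.image (fun x => ρ x.1 true x.2.2.1) ∪ S.image fun x => ρ x.2.1 false x.2.2.2.1)
    refine ⟨(a, b, s, t, P), hP, fun x hx => ⟨?_, fun heq => ha ?_, fun heq => hb ?_⟩⟩
    · exact ((Finset.disjoint_biUnion_right _ _ _).1 hPE x hx).symm
    · exact Finset.mem_union_left _ (Finset.mem_image.2 ⟨x, hx, heq⟩)
    · exact Finset.mem_union_right _ (Finset.mem_image.2 ⟨x, hx, heq⟩))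
  refine ⟨_, _, _, _, _, hF, ?_, ?_, ?_⟩
  · intro i j hij
    rcases hij.lt_or_gt with h1 | h1
    · exact (hFr _ _ h1).1
    · exact (hFr _ _ h1).1.symm
  · intro i j hij
    rcases lt_trichotomy i j with h1 | h1 | h1
    · exact absurd hij (hFr _ _ h1).2.1
    · exact h1
    · exact absurd hij.symm (hFr _ _ h1).2.1
  · intro i j hij
    rcases lt_trichotomy i j with h1 | h1 | h1
    · exact absurd hij (hFr _ _ h1).2.2
    · exact h1
    · exact absurd hij.symm (hFr _ _ h1).2.2

/-- All but at most one value are avoided almost everywhere by a given sequence. -/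
lemma finite_not_eventually_ne (U : Ultrafilter ℕ) (a : ℕ → ℕ) :
    {c | ¬ ∀ᶠ i in (U : Filter ℕ), a i ≠ c}.Finite := by
  refine Set.Subsingleton.finite fun c hc c' hc' => ?_
  simp only [Set.mem_ofPred_eq, ← Ultrafilter.eventually_not, not_not] at hc hc'
  obtain ⟨i, h1, h2⟩ := (hc.and hc').exists
  exact h1.symm.trans h2

lemma eventually_le_of_injective {a s : ℕ → ℕ} {ρ : ℕ → ℕ → V}
    (hinj : Function.Injective fun i => ρ (a i) (s i)) (q e : ℕ) :
    ∀ᶠ i in (Filter.hyperfilter ℕ : Filter ℕ), a i = q → e ≤ s i := by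
  refine Filter.hyperfilter_le_cofinite ?_
  rw [Filter.mem_cofinite]
  refine (((Set.finite_Iio e).image (ρ q)).preimage hinj.injOn).subset fun i hi => ?_
  simp only [Set.mem_compl_iff, Set.mem_ofPred_eq, Classical.not_imp, not_le] at hi
  obtain ⟨rfl, hlt⟩ := hi
  exact ⟨s i, hlt, rfl⟩

lemma exists_isDoubleRay [Countable V] (h : RaySystem G ρ) :
    ∃ F : ℕ → ℤ → V, (∀ i, IsDoubleRay G (F i)) ∧
      Pairwise fun i j => Disjoint (drEdges (F i)) (drEdges (F j)) := by
  classical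
  obtain ⟨ρ, h, hfin⟩ := h.exists_locally_finite
  obtain ⟨a, b, s, t, P, hP, hPd, hs, ht⟩ := h.exists_seq_isConnector hfin
  let U := Filter.hyperfilter ℕ
  obtain ⟨x, hx, hxr⟩ := exists_seq_of_forall_finset_exists (α := ℕ × ℕ × ℕ × ℕ)
    (fun x => (∀ᶠ i in (U : Filter ℕ), a i ≠ x.2.1) ∧ (∀ᶠ i in (U : Filter ℕ), b i ≠ x.2.1) ∧
      s x.1 ≤ x.2.2.1 ∧ t x.1 ≤ x.2.2.2 ∧
      ρ (a x.1) true x.2.2.1 ∈ Set.range (ρ x.2.1 true) ∧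
      ρ (b x.1) false x.2.2.2 ∈ Set.range (ρ x.2.1 false))
    (fun x y => x.1 ≠ y.1 ∧ x.2.1 ≠ y.2.1 ∧ a y.1 ≠ x.2.1 ∧ b y.1 ≠ x.2.1 ∧
      a x.1 ≠ y.2.1 ∧ b x.1 ≠ y.2.1 ∧ (a y.1 = a x.1 → x.2.2.1 ≤ s y.1) ∧
      (b y.1 = b x.1 → x.2.2.2 ≤ t y.1)) (by
    intro S hS
    have hi : ∀ᶠ i in (U : Filter ℕ), ∀ x ∈ S, x.1 ≠ i ∧ a i ≠ x.2.1 ∧ b i ≠ x.2.1 ∧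
        (a i = a x.1 → x.2.2.1 ≤ s i) ∧ (b i = b x.1 → x.2.2.2 ≤ t i) := by
      refine (Filter.eventually_all_finset S).2 fun x hx => ?_
      filter_upwards [Nat.hyperfilter_le_atTop (Filter.eventually_gt_atTop x.1), (hS x hx).1,
        (hS x hx).2.1, eventually_le_of_injective (ρ := fun q => ρ q true) hs (a x.1) x.2.2.1,
        eventually_le_of_injective (ρ := fun q => ρ q false) ht (b x.1) x.2.2.2]
        with i h1 h2 h3 h4 h5
      exact ⟨h1.ne, h2, h3, h4, h5⟩
    obtain ⟨i, hi⟩ := hi.exists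
    obtain ⟨c, hc⟩ := ((finite_not_eventually_ne U a).union ((finite_not_eventually_ne U b).union
      (S.image (fun x => x.2.1) ∪ (S.image (fun x => a x.1) ∪
        S.image fun x => b x.1)).finite_toSet)).infinite_compl.nonempty
    simp only [Set.mem_compl_iff, Set.mem_union, Set.mem_ofPred_eq, not_or, not_not, Finset.mem_coe,
      Finset.mem_union, Finset.mem_image, not_exists, not_and] at hc
    obtain ⟨hca, hcb, hc1, hc2, hc3⟩ := hc
    obtain ⟨n, n', hn, -, heq⟩ := h.meet (a i) c true (s i) 0
    obtain ⟨m, m', hm, -, heq'⟩ := h.meet (b i) c false (t i) 0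
    refine ⟨(i, c, n, m), ⟨hca, hcb, hn, hm, ⟨n', heq.symm⟩, ⟨m', heq'.symm⟩⟩, fun x hx => ?_⟩
    obtain ⟨h1, h2, h3, h4, h5⟩ := hi x hx
    exact ⟨h1, hc1 x hx, h2, h3, hc2 x hx, hc3 x hx, h4, h5⟩)
  have hF := fun n => h.exists_isDoubleRay_linkEdges (hP (x n).1) (hx n).2.2.1 (hx n).2.2.2.1
    (hx n).2.2.2.2.1 (hx n).2.2.2.2.2
  choose F hF hFsub using hF
  have key : ∀ m n, m < n → Disjoint (drEdges (F m)) (drEdges (F n)) := by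
    intro m n hmn
    obtain ⟨h1, h2, h3, h4, h5, h6, h7, h8⟩ := hxr m n hmn
    exact (h.disjoint_linkEdges (hP _) (hP _) (hPd _ _ h1) h2 h3 h4 h5 h6 h7 h8).mono
      (hFsub m) (hFsub n)
  refine ⟨F, hF, fun m n hmn => ?_⟩
  rcases hmn.lt_or_gt with h1 | h1
  · exact key _ _ h1
  · exact (key _ _ h1).symm

end RaySystem

end Assembly
/-- A countable graph with a thin end `ω` (represented by `W`) and arbitrarily many
pairwise edge-disjoint double rays both of whose constituent rays converge to `ω`
contains infinitely many pairwise edge-disjoint double rays. -/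
theorem stmt_17 (G : SimpleGraph V) [Countable V]
    (W : ℕ → V) (k : ℕ) (hW : IsRay G W) (hdeg : EndVertexDegree G W k)
    (h : ∀ n : ℕ, ∃ F : Fin n → ℤ → V,
      (∀ i, IsDoubleRay G (F i) ∧ RayEquiv G W (drFwd (F i)) ∧ RayEquiv G W (drBwd (F i))) ∧
      Pairwise fun i j => Disjoint (drEdges (F i)) (drEdges (F j))) :
    ∃ F : ℕ → ℤ → V, (∀ i, IsDoubleRay G (F i)) ∧
      Pairwise fun i j => Disjoint (drEdges (F i)) (drEdges (F j)) := by
  obtain ⟨Z, K, T, C, hS, hC⟩ := exists_sepSeq hW hdeg.2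
  have hpairs : ∀ n : ℕ, ∃ F : Fin n → (Bool → ℕ → V) × Set (Sym2 V),
      (∀ i, RayPair G Z C (F i).1 (F i).2) ∧ Pairwise fun i j => Disjoint (F i).2 (F j).2 := by
    intro n
    obtain ⟨F, hF, hd⟩ := h n
    have := fun i => (hF i).1.exists_rayPair (Z := Z) (hC _ (hF i).1.isRay_drFwd (hF i).2.1)
      (hC _ (hF i).1.isRay_drBwd (hF i).2.2)
    choose D hD using this
    exact ⟨fun i => (D i, drEdges (F i)), hD, hd⟩
  obtain ⟨T', C', D, E, hS', hD⟩ := hS.exists_rayTableau hpairs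
  obtain ⟨ρ, hρ⟩ := hD.exists_raySystem hS'
  exact hρ.exists_isDoubleRay
end

section
/- If a graph G contains, for every k ∈ ℕ, a family of k pairwise edge-disjoint 2-rays, then G contains an infinite family of pairwise edge-disjoint 2-rays. -/
open SimpleGraph

variable {V : Type*}

/-- A `2`-ray: an ordered pair of vertex-disjoint rays. -/
def Is2Ray (G : SimpleGraph V) (p : (ℕ → V) × (ℕ → V)) : Prop :=
  IsRay G p.1 ∧ IsRay G p.2 ∧ Disjoint (Set.range p.1) (Set.range p.2)

/-- The edges used by a `2`-ray. -/
def twoRayEdges (p : (ℕ → V) × (ℕ → V)) : Set (Sym2 V) := rayEdges p.1 ∪ rayEdges p.2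


/-! ### Rays as orbits of injective maps -/

/-- The map moving every vertex of the sequence `a` to the next one and fixing all other
vertices. -/
noncomputable def shift (a : ℕ → V) : V → V :=
  Function.extend a (fun n => a (n + 1)) id

theorem shift_apply {a : ℕ → V} (ha : Function.Injective a) (n : ℕ) : shift a (a n) = a (n + 1) :=
  ha.extend_apply _ _ n

theorem shift_of_notMem {a : ℕ → V} {v : V} (hv : v ∉ Set.range a) : shift a v = v :=
  Function.extend_apply' _ _ _ hv

theorem shift_injective {a : ℕ → V} (ha : Function.Injective a) :
    Function.Injective (shift a) := by
  intro u v h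
  by_cases hu : u ∈ Set.range a <;> by_cases hv : v ∈ Set.range a
  · obtain ⟨m, rfl⟩ := hu
    obtain ⟨n, rfl⟩ := hv
    rw [shift_apply ha, shift_apply ha] at h
    have := ha h
    rw [Nat.add_right_cancel this]
  · obtain ⟨m, rfl⟩ := hu
    rw [shift_apply ha, shift_of_notMem hv] at h
    exact absurd ⟨_, h⟩ hv
  · obtain ⟨n, rfl⟩ := hv
    rw [shift_apply ha, shift_of_notMem hu] at h
    exact absurd ⟨_, h.symm⟩ hu
  · rwa [shift_of_notMem hu, shift_of_notMem hv] at h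

theorem shift_ne_zero {a : ℕ → V} (ha : Function.Injective a) (v : V) : shift a v ≠ a 0 := by
  intro h
  by_cases hv : v ∈ Set.range a
  · obtain ⟨m, rfl⟩ := hv
    rw [shift_apply ha] at h
    exact absurd (ha h) (Nat.succ_ne_zero m)
  · rw [shift_of_notMem hv] at h
    exact hv ⟨0, h.symm⟩

/-- The map moving every vertex of a `2`-ray to the next one on its ray and fixing all other
vertices. -/
noncomputable def twoShift (p : (ℕ → V) × (ℕ → V)) (v : V) : V := shift p.1 (shift p.2 v)

section TwoShift

variable {G : SimpleGraph V} {p : (ℕ → V) × (ℕ → V)}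

theorem Is2Ray.twoShift_injective (hp : Is2Ray G p) : Function.Injective (twoShift p) :=
  (shift_injective hp.1.1).comp (shift_injective hp.2.1.1)

theorem Is2Ray.twoShift_ne_fst (hp : Is2Ray G p) (v : V) : twoShift p v ≠ p.1 0 :=
  shift_ne_zero hp.1.1 _

theorem Is2Ray.twoShift_ne_snd (hp : Is2Ray G p) (v : V) : twoShift p v ≠ p.2 0 := by
  intro h
  have hd : p.2 0 ∉ Set.range p.1 := fun hm => Set.disjoint_left.1 hp.2.2 hm ⟨0, rfl⟩
  have h' : shift p.1 (shift p.2 v) = shift p.1 (p.2 0) := by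
    rw [shift_of_notMem hd]; exact h
  exact shift_ne_zero hp.2.1.1 v (shift_injective hp.1.1 h')

theorem Is2Ray.mk_twoShift_mem (hp : Is2Ray G p) {v : V} (hv : twoShift p v ≠ v) :
    s(v, twoShift p v) ∈ twoRayEdges p := by
  unfold twoShift at *
  by_cases h2 : v ∈ Set.range p.2
  · obtain ⟨n, rfl⟩ := h2
    have hd : p.2 (n + 1) ∉ Set.range p.1 := fun hm => Set.disjoint_left.1 hp.2.2 hm ⟨_, rfl⟩
    rw [shift_apply hp.2.1.1, shift_of_notMem hd]
    exact Or.inr ⟨n, rfl⟩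
  · rw [shift_of_notMem h2] at hv ⊢
    by_cases h1 : v ∈ Set.range p.1
    · obtain ⟨n, rfl⟩ := h1
      rw [shift_apply hp.1.1]
      exact Or.inl ⟨n, rfl⟩
    · exact absurd (shift_of_notMem h1) hv

theorem Is2Ray.adj_of_mem (hp : Is2Ray G p) {u v : V} (h : s(u, v) ∈ twoRayEdges p) :
    G.Adj u v := by
  rw [← SimpleGraph.mem_edgeSet]
  rcases h with ⟨n, h⟩ | ⟨n, h⟩
  · rw [h]; exact hp.1.2 n
  · rw [h]; exact hp.2.1.2 n

theorem Is2Ray.twoShift_eq_or_adj (hp : Is2Ray G p) (v : V) :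
    twoShift p v = v ∨ G.Adj v (twoShift p v) :=
  or_iff_not_imp_left.2 fun h => hp.adj_of_mem (hp.mk_twoShift_mem h)

end TwoShift

section Orbit

variable {G : SimpleGraph V} {f : V → V}

theorem iterate_eq_iterate (hf : Function.Injective f) {a b : V} (ha : ∀ v, f v ≠ a)
    (hb : ∀ v, f v ≠ b) {m n : ℕ} (h : f^[m] a = f^[n] b) : m = n ∧ a = b := by
  induction m generalizing n with
  | zero =>
    cases n with
    | zero => exact ⟨rfl, h⟩
    | succ n =>
      rw [Function.iterate_succ_apply'] at h
      exact absurd h.symm (ha _)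
  | succ m ih =>
    cases n with
    | zero =>
      rw [Function.iterate_succ_apply'] at h
      exact absurd h (hb _)
    | succ n =>
      rw [Function.iterate_succ_apply', Function.iterate_succ_apply'] at h
      exact (ih (hf h)).imp (congrArg _) id

theorem isRay_iterate (hf : Function.Injective f) (hadj : ∀ v, f v = v ∨ G.Adj v (f v)) {a : V}
    (ha : ∀ v, f v ≠ a) : IsRay G (fun n => f^[n] a) := by
  have hinj : Function.Injective (fun n => f^[n] a) :=
    fun m n h => (iterate_eq_iterate hf ha ha h).1
  refine ⟨hinj, fun n => ?_⟩
  have h := hadj (f^[n] a)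
  rw [← Function.iterate_succ_apply' f] at h
  exact h.resolve_left fun h => Nat.succ_ne_self n (hinj h)

theorem is2Ray_iterate (hf : Function.Injective f) (hadj : ∀ v, f v = v ∨ G.Adj v (f v)) {a b : V}
    (ha : ∀ v, f v ≠ a) (hb : ∀ v, f v ≠ b) (hab : a ≠ b) :
    Is2Ray G (fun n => f^[n] a, fun n => f^[n] b) := by
  refine ⟨isRay_iterate hf hadj ha, isRay_iterate hf hadj hb, Set.disjoint_left.2 ?_⟩
  rintro _ ⟨m, rfl⟩ ⟨n, h⟩
  exact hab (iterate_eq_iterate hf hb ha h).2.symm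

end Orbit

theorem IsRay.tail {G : SimpleGraph V} {a : ℕ → V} (ha : IsRay G a) (N : ℕ) :
    IsRay G (fun n => a (n + N)) := by
  refine ⟨fun m n h => Nat.add_right_cancel (ha.1 h), fun n => ?_⟩
  have := ha.2 (n + N)
  rwa [Nat.add_right_comm] at this

theorem rayEdges_tail_subset (a : ℕ → V) (N : ℕ) :
    rayEdges (fun n => a (n + N)) ⊆ rayEdges a := by
  rintro _ ⟨n, rfl⟩
  exact ⟨n + N, by rw [Nat.add_right_comm]⟩

theorem exists_tail_notMem {a : ℕ → V} (ha : Function.Injective a) {S : Set V} (hS : S.Finite) :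
    ∃ N, ∀ n, a (n + N) ∉ S := by
  obtain ⟨N, hN⟩ := (hS.preimage ha.injOn).bddAbove
  refine ⟨N + 1, fun n hn => ?_⟩
  have := hN hn
  omega

/-- Every `2`-ray has a tail avoiding a given finite set of vertices. -/
theorem Is2Ray.exists_tail {G : SimpleGraph V} {p : (ℕ → V) × (ℕ → V)} (hp : Is2Ray G p)
    {S : Set V} (hS : S.Finite) :
    ∃ q, Is2Ray G q ∧ twoRayEdges q ⊆ twoRayEdges p ∧
      (∀ n, q.1 n ∉ S ∧ q.1 n ∈ Set.range p.1) ∧ ∀ n, q.2 n ∉ S ∧ q.2 n ∈ Set.range p.2 := by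
  obtain ⟨M, hM⟩ := exists_tail_notMem hp.1.1 hS
  obtain ⟨N, hN⟩ := exists_tail_notMem hp.2.1.1 hS
  refine ⟨(fun n => p.1 (n + M), fun n => p.2 (n + N)),
    ⟨hp.1.tail M, hp.2.1.tail N, hp.2.2.mono ?_ ?_⟩,
    Set.union_subset_union (rayEdges_tail_subset _ _) (rayEdges_tail_subset _ _),
    fun n => ⟨hM n, _, rfl⟩, fun n => ⟨hN n, _, rfl⟩⟩
  · rintro _ ⟨n, rfl⟩; exact ⟨_, rfl⟩
  · rintro _ ⟨n, rfl⟩; exact ⟨_, rfl⟩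

/-- A family of injective maps moving vertices along edges, indexed by levels, can be glued to
one such map if maps of consecutive levels cross the boundary between these levels at the same
vertices. -/
theorem exists_glued_map {G : SimpleGraph V} (ℓ : V → ℕ) (hℓ : ∀ u v, G.Adj u v → ℓ v ≤ ℓ u + 1)
    (f : ℕ → V → V) (hinj : ∀ m, Function.Injective (f m))
    (hadj : ∀ m v, f m v = v ∨ G.Adj v (f m v))
    (hout : ∀ m v, ℓ v = m + 1 → (ℓ (f m v) ≤ m ↔ ℓ (f (m + 1) v) ≤ m))
    (hin : ∀ m v, ℓ v = m + 1 →
      ((∃ w, ℓ w ≤ m ∧ f m w = v) ↔ ∃ w, ℓ w ≤ m ∧ f (m + 1) w = v)) :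
    ∃ g : V → V, Function.Injective g ∧ ∀ v, f (min (ℓ v) (ℓ (g v))) v = g v := by
  have key : ∀ v, ∃ w, f (min (ℓ v) (ℓ w)) v = w := by
    intro v
    by_cases h : ℓ (f (ℓ v) v) < ℓ v
    · obtain ⟨m, hm⟩ := Nat.exists_eq_succ_of_ne_zero (Nat.ne_zero_of_lt h)
      have h1 : ℓ (f m v) ≤ m := by
        rw [hout m v hm]
        rw [hm] at h
        exact Nat.lt_succ_iff.1 h
      have h2 : ℓ v ≤ ℓ (f m v) + 1 := by
        rcases hadj m v with h' | h'
        · rw [h']; omega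
        · exact hℓ _ _ h'.symm
      exact ⟨f m v, by rw [show min (ℓ v) (ℓ (f m v)) = m by omega]⟩
    · exact ⟨f (ℓ v) v, by rw [min_eq_left (not_lt.1 h)]⟩
  choose g hg using key
  have hstep : ∀ v, ℓ (g v) ≤ ℓ v + 1 := by
    intro v
    have := hadj (min (ℓ v) (ℓ (g v))) v
    rw [hg] at this
    rcases this with h | h
    · rw [h]; omega
    · exact hℓ _ _ h
  have hlt : ∀ u u', g u = g u' → min (ℓ u) (ℓ (g u)) < min (ℓ u') (ℓ (g u')) → False := by
    intro u u' h hlt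
    have h1 := hstep u
    have hu := hg u
    have hu' := hg u'
    rw [← h] at hlt hu'
    have hm : ℓ (g u) = ℓ u + 1 := by omega
    have hm' : min (ℓ u') (ℓ (g u)) = ℓ u + 1 := by omega
    rw [hm', ← hu] at hu'
    rw [show min (ℓ u) (ℓ (g u)) = ℓ u by omega] at hu
    rw [show min (ℓ u) (ℓ (g u)) = ℓ u by omega] at hu'
    obtain ⟨w, hw, hw'⟩ := (hin (ℓ u) (g u) hm).1 ⟨u, le_rfl, hu⟩
    rw [hu, ← hw'] at hu'
    have := hinj _ hu'
    rw [this] at hm'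
    omega
  refine ⟨g, fun u u' h => ?_, hg⟩
  rcases lt_trichotomy (min (ℓ u) (ℓ (g u))) (min (ℓ u') (ℓ (g u'))) with h' | h' | h'
  · exact (hlt _ _ h h').elim
  · have h1 := hg u
    rw [h', h, ← hg u'] at h1
    simp only [hg] at h1
    exact hinj _ (h1.trans (hg u').symm)
  · exact (hlt _ _ h.symm h').elim

/-! ### Hall's condition and thin exhaustions -/

section Hall

variable [DecidableEq V]

open scoped Classical in
/-- Hall's condition for the existence of an injective map `f : V → V` avoiding `A` with `f v`
in the finite set `N v` for all `v`. -/
def HallAvoiding (N : V → Finset V) (A : Set V) : Prop :=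
  ∀ W : Finset V, W.card ≤ ((W.biUnion N).filter (· ∉ A)).card

theorem HallAvoiding.exists_injective {N : V → Finset V} {A : Set V} (h : HallAvoiding N A) :
    ∃ f : V → V, Function.Injective f ∧ ∀ v, f v ∈ N v ∧ f v ∉ A := by
  classical
  obtain ⟨f, hf, hf'⟩ := (Finset.all_card_le_biUnion_card_iff_exists_injective
    (fun v => (N v).filter (· ∉ A))).1 (fun W => by
      rw [← Finset.filter_biUnion]
      exact h W)
  exact ⟨f, hf, fun v => Finset.mem_filter.1 (hf' v)⟩

open scoped Classical in
theorem HallAvoiding.tight_union {N : V → Finset V} {A : Set V} (h : HallAvoiding N A)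
    {W₁ W₂ : Finset V} (h₁ : ((W₁.biUnion N).filter (· ∉ A)).card ≤ W₁.card)
    (h₂ : ((W₂.biUnion N).filter (· ∉ A)).card ≤ W₂.card) :
    (((W₁ ∪ W₂).biUnion N).filter (· ∉ A)).card ≤ (W₁ ∪ W₂).card := by
  have e1 := Finset.card_union_add_card_inter ((W₁.biUnion N).filter (· ∉ A))
    ((W₂.biUnion N).filter (· ∉ A))
  have e2 := Finset.card_union_add_card_inter W₁ W₂
  have e3 := h (W₁ ∩ W₂)
  have e4 : (((W₁ ∩ W₂).biUnion N).filter (· ∉ A)).card ≤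
      ((W₁.biUnion N).filter (· ∉ A) ∩ (W₂.biUnion N).filter (· ∉ A)).card := by
    refine Finset.card_le_card fun x hx => ?_
    simp only [Finset.mem_filter, Finset.mem_biUnion, Finset.mem_inter] at hx ⊢
    obtain ⟨⟨w, ⟨hw1, hw2⟩, hx⟩, hA⟩ := hx
    exact ⟨⟨⟨w, hw1, hx⟩, hA⟩, ⟨w, hw2, hx⟩, hA⟩
  rw [← Finset.filter_union, ← Finset.union_biUnion] at e1
  omega

open scoped Classical in
/-- If `A` is maximal with Hall's condition, then every finite set is covered, up to `A`, by the
neighbourhood of a finite set that is tight for `A`. -/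
theorem exists_tight_of_maximal {N : V → Finset V} {A : Set V} (h : Maximal (HallAvoiding N) A)
    (X : Finset V) : ∃ W : Finset V, ((W.biUnion N).filter (· ∉ A)).card ≤ W.card ∧
      ∀ x ∈ X, x ∉ A → x ∈ W.biUnion N := by
  induction X using Finset.induction_on with
  | empty => exact ⟨∅, by simp⟩
  | insert a X _ ih =>
    obtain ⟨W, hW, hX⟩ := ih
    by_cases ha : a ∈ A
    · refine ⟨W, hW, fun x hx hxA => ?_⟩
      rcases Finset.mem_insert.1 hx with rfl | hx
      · exact absurd ha hxA
      · exact hX x hx hxA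
    · have hnot : ¬ HallAvoiding N (insert a A) := fun hh =>
        ha (h.2 hh (Set.subset_insert a A) (Set.mem_insert a A))
      obtain ⟨W', hW'⟩ := not_forall.1 hnot
      rw [not_le] at hW'
      have hW' : (((W'.biUnion N).filter (· ∉ A)).erase a).card < W'.card := by
        refine lt_of_eq_of_lt (congrArg Finset.card ?_) hW'
        ext x
        simp only [Finset.mem_filter, Set.mem_insert_iff, Finset.mem_erase, not_or]
        tauto
      have haW' : a ∈ (W'.biUnion N).filter (· ∉ A) := by
        by_contra hc
        rw [Finset.erase_eq_of_notMem hc] at hW'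
        exact absurd (h.1 W') (not_le.2 hW')
      rw [Finset.card_erase_of_mem haW'] at hW'
      refine ⟨W ∪ W', h.1.tight_union hW (by omega), fun x hx hxA => ?_⟩
      rw [Finset.union_biUnion, Finset.mem_union]
      rcases Finset.mem_insert.1 hx with rfl | hx
      · exact Or.inr (Finset.mem_filter.1 haW').1
      · exact Or.inl (hX x hx hxA)

theorem exists_maximal_hallAvoiding {N : V → Finset V} (hN : ∀ v, v ∈ N v) :
    ∃ A, Maximal (HallAvoiding N) A := by
  classical
  obtain ⟨A, -, hA⟩ := zorn_subset_nonempty {A | HallAvoiding N A} (fun c hc hchain hne => by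
    refine ⟨⋃₀ c, fun W => ?_, fun s hs => Set.subset_sUnion_of_mem hs⟩
    obtain ⟨B, hB, hBsub⟩ := hchain.directedOn.exists_mem_subset_of_finset_subset_biUnion
      (f := id) hne (s := (W.biUnion N).filter (· ∈ ⋃₀ c)) (by
        intro x hx
        have := (Finset.mem_filter.1 (Finset.mem_coe.1 hx)).2
        rwa [Set.sUnion_eq_biUnion] at this)
    refine (hc hB W).trans (Finset.card_le_card fun x hx => ?_)
    rw [Finset.mem_filter] at hx ⊢
    exact ⟨hx.1, fun h => hx.2 (hBsub (Finset.mem_coe.2 (Finset.mem_filter.2 ⟨hx.1, h⟩)))⟩)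
    ∅ (fun W => by
      refine Finset.card_le_card fun x hx => ?_
      simp only [Set.mem_empty_iff_false, not_false_eq_true, Finset.filter_true]
      exact Finset.mem_biUnion.2 ⟨x, hx, hN x⟩)
  exact ⟨A, hA⟩

/-- A finite maximal set with Hall's condition yields arbitrarily large finite sets with small
boundary. -/
theorem exists_superset_card_boundary_le {N : V → Finset V} (hN : ∀ v, v ∈ N v)
    {A : Finset V} (h : Maximal (HallAvoiding N) (A : Set V)) (X : Finset V) :
    ∃ W, X ⊆ W ∧ (W.biUnion N \ W).card ≤ 2 * A.card := by
  classical
  obtain ⟨W, hW, hX⟩ := exists_tight_of_maximal h (X.biUnion N)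
  refine ⟨W ∪ X, Finset.subset_union_right, ?_⟩
  have hsub : (W ∪ X).biUnion N \ (W ∪ X) ⊆ (W.biUnion N \ W) ∪ A := by
    intro x hx
    simp only [Finset.mem_sdiff, Finset.mem_union, not_or, Finset.union_biUnion] at hx ⊢
    by_cases hA : x ∈ A
    · exact Or.inr hA
    · refine Or.inl ⟨hx.1.elim id fun hxX => hX x hxX (by simpa using hA), hx.2.1⟩
  have hWN : W ⊆ W.biUnion N := fun x hx => Finset.mem_biUnion.2 ⟨x, hx, hN x⟩
  have h1 := Finset.card_sdiff_add_card_eq_card hWN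
  have h2 := Finset.card_filter_add_card_filter_not (s := W.biUnion N) (· ∈ (A : Set V))
  have h3 : ((W.biUnion N).filter (· ∈ (A : Set V))).card ≤ A.card :=
    Finset.card_le_card fun x hx => by simpa using (Finset.mem_filter.1 hx).2
  have h5 : ((W.biUnion N).filter (¬ · ∈ (A : Set V))).card ≤ W.card := by convert hW
  have h4 := (Finset.card_le_card hsub).trans (Finset.card_union_le _ _)
  omega

end Hall

/-- In a countable locally finite graph there are infinitely many disjoint rays, or the vertices
can be arranged in finite levels separated by boundaries of bounded size. -/
theorem exists_disjoint_rays_or_levels [Countable V] {G : SimpleGraph V}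
    (hG : ∀ v, {w | G.Adj v w}.Finite) :
    (∃ R : ℕ → ℕ → V, (∀ i, IsRay G (R i)) ∧
      Pairwise fun i j => Disjoint (Set.range (R i)) (Set.range (R j))) ∨
    ∃ (n : ℕ) (ℓ : V → ℕ), (∀ i, {v | ℓ v ≤ i}.Finite) ∧ (∀ u v, G.Adj u v → ℓ v ≤ ℓ u + 1) ∧
      ∀ i, ∃ B : Finset V, B.card ≤ n ∧ ∀ u v, G.Adj u v → ℓ u ≤ i → i < ℓ v → v ∈ B := by
  classical
  let N : V → Finset V := fun v => insert v (hG v).toFinset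
  have hmem : ∀ u v, u ∈ N v ↔ u = v ∨ G.Adj v u := fun u v => by simp [N]
  have hN : ∀ v, v ∈ N v := fun v => (hmem v v).2 (Or.inl rfl)
  obtain ⟨A, hA⟩ := exists_maximal_hallAvoiding hN
  by_cases hfin : A.Finite
  · right
    lift A to Finset V using hfin
    choose S hS hcard using exists_superset_card_boundary_le hN hA
    obtain ⟨e, he⟩ := exists_injective_nat V
    have hefin : ∀ i, {v | e v ≤ i}.Finite := fun i =>
      (Set.finite_Iic i).preimage he.injOn
    let W : ℕ → Finset V := fun i =>
      Nat.rec (S ∅) (fun i W => S (W.biUnion N ∪ (hefin i).toFinset)) i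
    have hWsucc : ∀ i, (W i).biUnion N ∪ (hefin i).toFinset ⊆ W (i + 1) := fun i => hS _
    have hWN : ∀ i, (W i).biUnion N ⊆ W (i + 1) :=
      fun i => Finset.subset_union_left.trans (hWsucc i)
    have hWcard : ∀ i, ((W i).biUnion N \ W i).card ≤ 2 * A.card := by
      intro i
      cases i <;> exact hcard _
    have hWmono : Monotone W := monotone_nat_of_le_succ fun i x hx =>
      hWN i (Finset.mem_biUnion.2 ⟨x, hx, hN x⟩)
    have hex : ∀ v, ∃ i, v ∈ W i := fun v =>
      ⟨e v + 1, hWsucc _ (Finset.mem_union_right _ (by simp))⟩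
    let ℓ : V → ℕ := fun v => sInf {i | v ∈ W i}
    have hspec : ∀ v, v ∈ W (ℓ v) := fun v => Nat.sInf_mem (hex v)
    have hle : ∀ v i, ℓ v ≤ i ↔ v ∈ W i := fun v i =>
      ⟨fun h => hWmono h (hspec v), fun h => Nat.sInf_le h⟩
    refine ⟨2 * A.card, ℓ, fun i => ?_, fun u v huv => ?_, fun i =>
      ⟨_, hWcard i, fun u v huv hu hv => ?_⟩⟩
    · simp only [hle]
      exact (W i).finite_toSet
    · rw [hle]
      exact hWN _ (Finset.mem_biUnion.2 ⟨u, hspec u, (hmem _ _).2 (Or.inr huv)⟩)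
    · rw [hle] at hu
      rw [← not_le, hle] at hv
      exact Finset.mem_sdiff.2
        ⟨Finset.mem_biUnion.2 ⟨u, hu, (hmem _ _).2 (Or.inr huv)⟩, hv⟩
  · left
    obtain ⟨f, hf, hfN⟩ := hA.1.exists_injective
    have hinf : A.Infinite := hfin
    let a := hinf.natEmbedding
    have ha : ∀ i v, f v ≠ a i := fun i v h => (hfN v).2 (h ▸ (a i).2)
    refine ⟨fun i n => f^[n] (a i), fun i => isRay_iterate hf (fun v => (hmem _ _).1 (hfN v).1)
      (ha i), fun i j hij => Set.disjoint_left.2 ?_⟩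
    rintro _ ⟨m, rfl⟩ ⟨n, h⟩
    exact hij (a.injective (Subtype.ext (iterate_eq_iterate hf (ha j) (ha i) h).2)).symm

/-! ### Gluing `2`-rays along boundaries of bounded size -/

/-- The way in which a map moving vertices along edges crosses a boundary of size at most `n` is
determined by an element of a finite set. -/
theorem exists_shape {G : SimpleGraph V} {n : ℕ} {ℓ : V → ℕ}
    (hB : ∀ i, ∃ B : Finset V, B.card ≤ n ∧ ∀ u v, G.Adj u v → ℓ u ≤ i → i < ℓ v → v ∈ B) :
    ∃ shape : ℕ → (V → V) → Set (Fin n) × Set (Fin n), ∀ i f g,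
      (∀ v, f v = v ∨ G.Adj v (f v)) → (∀ v, g v = v ∨ G.Adj v (g v)) → shape i f = shape i g →
      ∀ v, ℓ v = i + 1 → (ℓ (f v) ≤ i ↔ ℓ (g v) ≤ i) ∧
        ((∃ w, ℓ w ≤ i ∧ f w = v) ↔ ∃ w, ℓ w ≤ i ∧ g w = v) := by
  choose B hcard hB using hB
  have he : ∀ i, Nonempty (B i ↪ Fin n) := fun i =>
    Function.Embedding.nonempty_of_card_le (by simpa using hcard i)
  let e : ∀ i, B i ↪ Fin n := fun i => (he i).some
  have hout : ∀ i (f : V → V), (∀ v, f v = v ∨ G.Adj v (f v)) → ∀ v, ℓ v = i + 1 →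
      ℓ (f v) ≤ i → v ∈ B i := by
    intro i f hf v hv h
    rcases hf v with h' | h'
    · rw [h'] at h; omega
    · exact hB i _ _ h'.symm h (by omega)
  have hin : ∀ i (f : V → V), (∀ v, f v = v ∨ G.Adj v (f v)) → ∀ v, ℓ v = i + 1 →
      (∃ w, ℓ w ≤ i ∧ f w = v) → v ∈ B i := by
    rintro i f hf v hv ⟨w, hw, rfl⟩
    rcases hf w with h' | h'
    · rw [h'] at hv; omega
    · exact hB i _ _ h' hw (by omega)
  refine ⟨fun i f => (e i '' {v | ℓ (f v) ≤ i}, e i '' {v | ∃ w, ℓ w ≤ i ∧ f w = v}),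
    fun i f g hf hg h v hv => ?_⟩
  rw [Prod.mk.injEq] at h
  have h1 := (e i).injective.image_injective h.1
  have h2 := (e i).injective.image_injective h.2
  by_cases hvB : v ∈ B i
  · exact ⟨Set.ext_iff.1 h1 ⟨v, hvB⟩, Set.ext_iff.1 h2 ⟨v, hvB⟩⟩
  · exact ⟨iff_of_false (fun h => hvB (hout i f hf v hv h)) fun h => hvB (hout i g hg v hv h),
      iff_of_false (fun h => hvB (hin i f hf v hv h)) fun h => hvB (hin i g hg v hv h)⟩

/-- A pigeonhole principle: from arbitrarily large families of pairwise related objects one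
obtains such families with all members of the same colour. -/
theorem exists_monochromatic_families {R T : Type*} [Finite T] (c : R → T) {P : R → Prop}
    {D : R → R → Prop} (h : ∀ k : ℕ, ∃ F : Fin k → R, (∀ i, P (F i)) ∧
      Pairwise fun i j => D (F i) (F j)) :
    ∃ t, ∀ k : ℕ, ∃ F : Fin k → R, (∀ i, P (F i) ∧ c (F i) = t) ∧
      Pairwise fun i j => D (F i) (F j) := by
  classical
  have := Fintype.ofFinite T
  by_contra hcon
  simp only [not_exists, not_forall] at hcon
  choose K hK using hcon
  obtain ⟨F, hF, hD⟩ := h (∑ t, K t + 1)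
  obtain ⟨t, ht⟩ : ∃ t, K t ≤ (Finset.univ.filter fun i => c (F i) = t).card := by
    by_contra! hlt
    have h1 := Finset.card_eq_sum_card_fiberwise (f := fun i => c (F i)) (s := Finset.univ)
      (t := Finset.univ) (fun _ _ => Finset.mem_coe.2 (Finset.mem_univ _))
    have h2 := Finset.sum_le_sum fun t (_ : t ∈ Finset.univ) => (hlt t).le
    rw [← h1, Finset.card_univ, Fintype.card_fin] at h2
    omega
  let o := Finset.orderEmbOfCardLe _ ht
  refine hK t (fun i => F (o i)) ⟨fun i => ⟨hF _, ?_⟩, fun i j hij => hD (o.injective.ne hij)⟩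
  exact (Finset.mem_filter.1 (Finset.orderEmbOfCardLe_mem _ ht i)).2

/-- There is a sequence growing from `c` to `c + 1` only at places in `J c`, and visiting every
value. -/
theorem exists_sequence_stepping_in {J : ℕ → Set ℕ} (hJ : ∀ c N, ∃ m, N ≤ m ∧ m ∈ J c) :
    ∃ κ : ℕ → ℕ, Monotone κ ∧ (∀ m, κ (m + 1) = κ m ∨ m ∈ J (κ m) ∧ κ (m + 1) = κ m + 1) ∧
      ∀ c, ∃ m, m ∈ J c ∧ κ m = c := by
  classical
  let κ : ℕ → ℕ := fun m => Nat.rec 0 (fun m c => if m ∈ J c then c + 1 else c) m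
  have hκ : ∀ m, κ (m + 1) = if m ∈ J (κ m) then κ m + 1 else κ m := fun m => rfl
  have hex : ∀ c, (∃ m, κ m = c) → ∃ m, m ∈ J c ∧ κ m = c := by
    rintro c ⟨m₀, h₀⟩
    by_contra! hcon
    have hconst : ∀ m, m₀ ≤ m → κ m = c := fun m hm => by
      induction m, hm using Nat.le_induction with
      | base => exact h₀
      | succ m _ ih => rw [hκ, ih, if_neg fun hm => hcon m hm ih]
    obtain ⟨m, hm, hmJ⟩ := hJ c m₀
    exact hcon m hmJ (hconst m hm)
  refine ⟨κ, monotone_nat_of_le_succ fun m => ?_, fun m => ?_, fun c => hex c ?_⟩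
  · rw [hκ]; split_ifs <;> omega
  · rw [hκ]; split_ifs with h
    · exact Or.inr ⟨h, rfl⟩
    · exact Or.inl rfl
  · induction c with
    | zero => exact ⟨0, rfl⟩
    | succ c ih =>
      obtain ⟨m, hm, hc⟩ := hex c ih
      exact ⟨m + 1, by rw [hκ, hc, if_pos hm]⟩

theorem exists_twoRays_of_levels {G : SimpleGraph V} {n : ℕ} {ℓ : V → ℕ}
    (hfin : ∀ i, {v | ℓ v ≤ i}.Finite) (hℓ : ∀ u v, G.Adj u v → ℓ v ≤ ℓ u + 1)
    (hB : ∀ i, ∃ B : Finset V, B.card ≤ n ∧ ∀ u v, G.Adj u v → ℓ u ≤ i → i < ℓ v → v ∈ B)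
    (h : ∀ k : ℕ, ∃ F : Fin k → (ℕ → V) × (ℕ → V), (∀ i, Is2Ray G (F i)) ∧
      Pairwise fun i j => Disjoint (twoRayEdges (F i)) (twoRayEdges (F j))) :
    ∃ F : ℕ → (ℕ → V) × (ℕ → V), (∀ i, Is2Ray G (F i)) ∧
      Pairwise fun i j => Disjoint (twoRayEdges (F i)) (twoRayEdges (F j)) := by
  obtain ⟨shape, hshape⟩ := exists_shape hB
  have hlim : ∀ p : (ℕ → V) × (ℕ → V), ∃ t,
      ∀ᶠ i in (Filter.hyperfilter ℕ : Filter ℕ), shape i (twoShift p) = t := by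
    intro p
    obtain ⟨t, ht⟩ := ((Filter.hyperfilter ℕ).map fun i => shape i (twoShift p)).eq_pure_of_finite
    refine ⟨t, ?_⟩
    have : {t} ∈ (Filter.hyperfilter ℕ).map fun i => shape i (twoShift p) := by
      rw [ht]; exact Set.mem_singleton t
    exact this
  choose c hc using hlim
  obtain ⟨t, ht⟩ := exists_monochromatic_families c (P := Is2Ray G)
    (D := fun p q => Disjoint (twoRayEdges p) (twoRayEdges q)) h
  have d : (ℕ → V) × (ℕ → V) := (h 1).choose 0
  choose F hF hdisj using ht
  let P : ℕ → ℕ → (ℕ → V) × (ℕ → V) := fun k => Function.extend Fin.val (F k) fun _ => d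
  have hPF : ∀ k x (hx : x < k), P k x = F k ⟨x, hx⟩ := fun k x hx =>
    Fin.val_injective.extend_apply (F k) _ ⟨x, hx⟩
  have hP : ∀ k x, x < k → Is2Ray G (P k x) := fun k x hx => hPF k x hx ▸ (hF k _).1
  have hPc : ∀ k x, x < k →
      ∀ᶠ i in (Filter.hyperfilter ℕ : Filter ℕ), shape i (twoShift (P k x)) = t := by
    intro k x hx
    rw [hPF k x hx, ← (hF k ⟨x, hx⟩).2]
    exact hc _
  have hPdisj : ∀ k x y, x < k → y < k → x ≠ y →
      Disjoint (twoRayEdges (P k x)) (twoRayEdges (P k y)) := by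
    intro k x y hx hy hxy
    rw [hPF k x hx, hPF k y hy]
    exact hdisj k (by simpa using hxy)
  let J : ℕ → Set ℕ := fun k => {m | (∀ x < k, shape m (twoShift (P k x)) = t) ∧
    (∀ x < k + 1, shape m (twoShift (P (k + 1) x)) = t) ∧
    ∀ x < k, ℓ ((P k x).1 0) ≤ m ∧ ℓ ((P k x).2 0) ≤ m}
  have hlarge : ∀ N, ∀ᶠ m in (Filter.hyperfilter ℕ : Filter ℕ), N ≤ m := fun N =>
    (Filter.eventually_ge_atTop N).filter_mono Nat.hyperfilter_le_atTop
  have hJ : ∀ k N, ∃ m, N ≤ m ∧ m ∈ J k := by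
    intro k N
    have hall : ∀ k, ∀ᶠ m in (Filter.hyperfilter ℕ : Filter ℕ),
        ∀ x < k, shape m (twoShift (P k x)) = t := fun k =>
      (Set.finite_Iio k).eventually_all.2 fun x hx => hPc k x hx
    have hstart : ∀ᶠ m in (Filter.hyperfilter ℕ : Filter ℕ),
        ∀ x < k, ℓ ((P k x).1 0) ≤ m ∧ ℓ ((P k x).2 0) ≤ m :=
      (Set.finite_Iio k).eventually_all.2 fun x _ => (hlarge _).and (hlarge _)
    exact ((hlarge N).and ((hall k).and ((hall (k + 1)).and hstart))).exists
  obtain ⟨κ, hmono, hstep, hvisit⟩ := exists_sequence_stepping_in hJ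
  have main : ∀ x, ∃ p, Is2Ray G p ∧ ∀ e ∈ twoRayEdges p, x < κ (e.map ℓ).inf ∧
      e ∈ twoRayEdges (P (κ (e.map ℓ).inf) x) := by
    intro x
    obtain ⟨s, hsJ, hs⟩ := hvisit (x + 1)
    have hx : ∀ m, x < κ (max m s) := fun m =>
      lt_of_lt_of_le (by omega) (hmono (le_max_right m s))
    have hlow : ∀ m, m ≤ s → κ (max m s) = x + 1 := fun m hm => by rw [max_eq_right hm, hs]
    have hq : ∀ m, Is2Ray G (P (κ (max m s)) x) := fun m => hP _ _ (hx m)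
    have hcross : ∀ m, twoShift (P (κ (max m s)) x) = twoShift (P (κ (max (m + 1) s)) x) ∨
        shape m (twoShift (P (κ (max m s)) x)) =
          shape m (twoShift (P (κ (max (m + 1) s)) x)) := by
      intro m
      by_cases hm : m < s
      · left; rw [hlow m hm.le, hlow (m + 1) hm]
      · have hxm := hx m
        rw [max_eq_left (by omega : s ≤ m)] at hxm ⊢
        rw [max_eq_left (by omega : s ≤ m + 1)]
        rcases hstep m with h' | ⟨h', h''⟩
        · left; rw [h']
        · right; rw [h'', h'.1 x hxm, h'.2.1 x (by omega)]
    have hcross' : ∀ m v, ℓ v = m + 1 → _ := fun m v hv =>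
      (hcross m).elim (fun h => (h ▸ ⟨Iff.rfl, Iff.rfl⟩ :
        (ℓ (twoShift (P (κ (max m s)) x) v) ≤ m ↔
          ℓ (twoShift (P (κ (max (m + 1) s)) x) v) ≤ m) ∧
        ((∃ w, ℓ w ≤ m ∧ twoShift (P (κ (max m s)) x) w = v) ↔
          ∃ w, ℓ w ≤ m ∧ twoShift (P (κ (max (m + 1) s)) x) w = v)))
      fun h => hshape m _ _ (hq m).twoShift_eq_or_adj (hq (m + 1)).twoShift_eq_or_adj h v hv
    obtain ⟨g, hg, hgf⟩ := exists_glued_map ℓ hℓ (fun m => twoShift (P (κ (max m s)) x))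
      (fun m => (hq m).twoShift_injective) (fun m => (hq m).twoShift_eq_or_adj)
      (fun m v hv => (hcross' m v hv).1) (fun m v hv => (hcross' m v hv).2)
    have h0 : Is2Ray G (P (x + 1) x) := hP _ _ (Nat.lt_succ_self x)
    have hstart := hsJ.2.2 x (Nat.lt_succ_self x)
    have hfix : ∀ v, ℓ (g v) ≤ s → twoShift (P (x + 1) x) v = g v := by
      intro v hv
      have := hgf v
      rwa [hlow _ ((min_le_right _ _).trans hv)] at this
    have ha : ∀ v, g v ≠ (P (x + 1) x).1 0 := fun v hv =>
      h0.twoShift_ne_fst v ((hfix v (hv ▸ hstart.1)).trans hv)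
    have hb : ∀ v, g v ≠ (P (x + 1) x).2 0 := fun v hv =>
      h0.twoShift_ne_snd v ((hfix v (hv ▸ hstart.2)).trans hv)
    have hab : (P (x + 1) x).1 0 ≠ (P (x + 1) x).2 0 := fun h =>
      Set.disjoint_left.1 h0.2.2 ⟨0, rfl⟩ ⟨0, h.symm⟩
    have hgadj : ∀ v, g v = v ∨ G.Adj v (g v) := fun v => by
      have := (hq (min (ℓ v) (ℓ (g v)))).twoShift_eq_or_adj v
      rwa [hgf v] at this
    have hray := is2Ray_iterate hg hgadj ha hb hab
    obtain ⟨p, hp, hpsub, hp1, hp2⟩ := hray.exists_tail (hfin s)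
    refine ⟨p, hp, fun e he => ?_⟩
    have hlev : s < (e.map ℓ).inf := by
      rcases he with ⟨m, rfl⟩ | ⟨m, rfl⟩
      · exact lt_min (not_le.1 (hp1 m).1) (not_le.1 (hp1 (m + 1)).1)
      · exact lt_min (not_le.1 (hp2 m).1) (not_le.1 (hp2 (m + 1)).1)
    obtain ⟨v, rfl⟩ : ∃ v, e = s(v, g v) := by
      rcases hpsub he with ⟨m, rfl⟩ | ⟨m, rfl⟩
      · exact ⟨g^[m] ((P (x + 1) x).1 0), by simp only [Function.iterate_succ_apply']⟩
      · exact ⟨g^[m] ((P (x + 1) x).2 0), by simp only [Function.iterate_succ_apply']⟩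
    have hinf : (s(v, g v).map ℓ).inf = min (ℓ v) (ℓ (g v)) := rfl
    rw [hinf] at hlev ⊢
    have hxm := hx (min (ℓ v) (ℓ (g v)))
    have hqm := hq (min (ℓ v) (ℓ (g v)))
    have hgv := hgf v
    rw [max_eq_left hlev.le] at hxm hqm hgv
    refine ⟨hxm, ?_⟩
    have hne : g v ≠ v := (hp.adj_of_mem he).ne'
    rw [← hgv] at hne
    have := hqm.mk_twoShift_mem hne
    rwa [hgv] at this
  choose p hp hpe using main
  refine ⟨p, hp, fun x y hxy => Set.disjoint_left.2 fun e hx hy => ?_⟩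
  exact Set.disjoint_left.1 (hPdisj _ x y (hpe x e hx).1 (hpe y e hy).1 hxy)
    (hpe x e hx).2 (hpe y e hy).2

/-- Edge-ubiquity of the `2`-ray in countable locally finite graphs. -/
theorem exists_twoRays_of_locallyFinite [Countable V] {G : SimpleGraph V}
    (hG : ∀ v, {w | G.Adj v w}.Finite)
    (h : ∀ k : ℕ, ∃ F : Fin k → (ℕ → V) × (ℕ → V), (∀ i, Is2Ray G (F i)) ∧
      Pairwise fun i j => Disjoint (twoRayEdges (F i)) (twoRayEdges (F j))) :
    ∃ F : ℕ → (ℕ → V) × (ℕ → V), (∀ i, Is2Ray G (F i)) ∧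
      Pairwise fun i j => Disjoint (twoRayEdges (F i)) (twoRayEdges (F j)) := by
  rcases exists_disjoint_rays_or_levels hG with ⟨R, hR, hdisj⟩ | ⟨n, ℓ, hfin, hℓ, hB⟩
  · refine ⟨fun i => (R (2 * i), R (2 * i + 1)),
      fun i => ⟨hR _, hR _, hdisj (by omega)⟩, fun i j hij => Set.disjoint_left.2 ?_⟩
    have hverts : ∀ m e, e ∈ rayEdges (R m) → ∀ v ∈ e, v ∈ Set.range (R m) := by
      rintro m _ ⟨n, rfl⟩ v hv
      rcases Sym2.mem_iff.1 hv with rfl | rfl <;> exact ⟨_, rfl⟩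
    have hne : ∀ m m', m ≠ m' → ∀ e, e ∈ rayEdges (R m) → e ∈ rayEdges (R m') → False := by
      rintro m m' hm _ ⟨n, rfl⟩ h'
      exact Set.disjoint_left.1 (hdisj hm) ⟨n, rfl⟩ (hverts m' _ h' _ (Sym2.mem_mk_left _ _))
    rintro e (he | he) (he' | he') <;> exact hne _ _ (by omega) e he he'
  · exact exists_twoRays_of_levels hfin hℓ hB h

/-! ### Reduction to countable locally finite graphs -/

theorem twoRayEdges_comp {W : Type*} (φ : V → W) (p : (ℕ → V) × (ℕ → V)) :
    twoRayEdges (φ ∘ p.1, φ ∘ p.2) = Sym2.map φ '' twoRayEdges p := by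
  have h : ∀ a : ℕ → V, rayEdges (φ ∘ a) = Sym2.map φ '' rayEdges a := by
    intro a
    ext e
    constructor
    · rintro ⟨n, rfl⟩; exact ⟨_, ⟨n, rfl⟩, rfl⟩
    · rintro ⟨_, ⟨n, rfl⟩, rfl⟩; exact ⟨n, rfl⟩
  simp only [twoRayEdges, h, Set.image_union]

theorem Is2Ray.comp {W : Type*} {G : SimpleGraph V} {H : SimpleGraph W} {φ : V → W}
    (hφ : Function.Injective φ) (hGH : ∀ u v, G.Adj u v → H.Adj (φ u) (φ v))
    {p : (ℕ → V) × (ℕ → V)} (hp : Is2Ray G p) : Is2Ray H (φ ∘ p.1, φ ∘ p.2) := by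
  refine ⟨⟨hφ.comp hp.1.1, fun n => hGH _ _ (hp.1.2 n)⟩,
    ⟨hφ.comp hp.2.1.1, fun n => hGH _ _ (hp.2.1.2 n)⟩, Set.disjoint_left.2 ?_⟩
  rintro _ ⟨m, rfl⟩ ⟨n, h⟩
  exact Set.disjoint_left.1 hp.2.2 ⟨m, rfl⟩ ⟨n, hφ h⟩

theorem finite_setOf_mk_mem_rayEdges {a : ℕ → V} (ha : Function.Injective a) (v : V) :
    {w | s(v, w) ∈ rayEdges a}.Finite := by
  by_cases hv : v ∈ Set.range a
  · obtain ⟨n, rfl⟩ := hv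
    refine ((Set.finite_Iic (n + 1)).image a).subset ?_
    rintro w ⟨m, hm⟩
    rcases Sym2.eq_iff.1 hm with ⟨h, rfl⟩ | ⟨h, rfl⟩
    · exact ⟨m + 1, by rw [ha h]; exact Set.mem_Iic.2 le_rfl, rfl⟩
    · exact ⟨m, by rw [ha h]; exact Set.mem_Iic.2 (by omega), rfl⟩
  · refine Set.finite_empty.subset ?_
    rintro w ⟨m, hm⟩
    rcases Sym2.eq_iff.1 hm with ⟨h, -⟩ | ⟨h, -⟩ <;> exact hv ⟨_, h.symm⟩

theorem mem_range_of_mk_mem_rayEdges {a : ℕ → V} {u v : V} (h : s(u, v) ∈ rayEdges a) :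
    u ∈ Set.range a := by
  obtain ⟨n, h⟩ := h
  rcases Sym2.eq_iff.1 h with ⟨h, -⟩ | ⟨h, -⟩ <;> exact ⟨_, h.symm⟩

/-- Edge-ubiquity of the `2`-ray: arbitrarily many pairwise edge-disjoint `2`-rays
give infinitely many. -/
theorem stmt_18 (G : SimpleGraph V)
    (h : ∀ k : ℕ, ∃ F : Fin k → (ℕ → V) × (ℕ → V), (∀ i, Is2Ray G (F i)) ∧
      Pairwise fun i j => Disjoint (twoRayEdges (F i)) (twoRayEdges (F j))) :
    ∃ F : ℕ → (ℕ → V) × (ℕ → V), (∀ i, Is2Ray G (F i)) ∧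
      Pairwise fun i j => Disjoint (twoRayEdges (F i)) (twoRayEdges (F j)) := by
  choose F hF hdisj using h
  let C : Set V := ⋃ k, ⋃ i, Set.range (F k i).1 ∪ Set.range (F k i).2
  have hC : C.Countable := Set.countable_iUnion fun k => Set.countable_iUnion fun i =>
    (Set.countable_range _).union (Set.countable_range _)
  have hFC : ∀ k i, Set.range (F k i).1 ∪ Set.range (F k i).2 ⊆ C := fun k i =>
    Set.subset_iUnion_of_subset k (Set.subset_iUnion_of_subset i subset_rfl)
  have : Countable C := hC.to_subtype
  obtain ⟨e, he⟩ := exists_injective_nat C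
  have hlift : ∀ k i, ∃ q : (ℕ → C) × (ℕ → C), Is2Ray (G.induce C) q ∧
      Sym2.map Subtype.val '' twoRayEdges q ⊆ twoRayEdges (F k i) ∧
      (∀ n, k < e (q.1 n)) ∧ ∀ n, k < e (q.2 n) := by
    intro k i
    have hS : (Subtype.val '' {v | e v ≤ k}).Finite :=
      ((Set.finite_Iic k).preimage he.injOn).image _
    obtain ⟨p, hp, hsub, h1, h2⟩ := (hF k i).exists_tail hS
    refine ⟨(fun n => ⟨p.1 n, hFC k i (Or.inl (h1 n).2)⟩,
      fun n => ⟨p.2 n, hFC k i (Or.inr (h2 n).2)⟩),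
      ⟨⟨fun m n h => hp.1.1 (congrArg Subtype.val h), hp.1.2⟩,
        ⟨fun m n h => hp.2.1.1 (congrArg Subtype.val h), hp.2.1.2⟩, Set.disjoint_left.2 ?_⟩,
      by rw [← twoRayEdges_comp]; exact hsub,
      fun n => not_le.1 fun h => (h1 n).1 ⟨_, h, rfl⟩,
      fun n => not_le.1 fun h => (h2 n).1 ⟨_, h, rfl⟩⟩
    rintro _ ⟨m, rfl⟩ ⟨n, h⟩
    exact Set.disjoint_left.1 hp.2.2 ⟨m, rfl⟩ ⟨n, congrArg Subtype.val h⟩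
  choose q hq hsub he1 he2 using hlift
  let H : SimpleGraph C :=
    { Adj := fun u v => ∃ k i, s(u, v) ∈ twoRayEdges (q k i)
      symm := ⟨fun u v ⟨k, i, h⟩ => ⟨k, i, Sym2.eq_swap (a := u) ▸ h⟩⟩
      loopless := ⟨fun u ⟨k, i, h⟩ => ((hq k i).adj_of_mem h).ne rfl⟩ }
  have hHG : ∀ u v, H.Adj u v → G.Adj u v := fun u v ⟨k, i, h⟩ => (hq k i).adj_of_mem h
  have hH : ∀ v, {w | H.Adj v w}.Finite := by
    intro v
    refine ((Set.finite_Iio (e v)).biUnion fun k _ => Set.finite_iUnion fun i =>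
      (finite_setOf_mk_mem_rayEdges (hq k i).1.1 v).union
        (finite_setOf_mk_mem_rayEdges (hq k i).2.1.1 v)).subset ?_
    rintro w ⟨k, i, h⟩
    refine Set.mem_biUnion (x := k) ?_ (Set.mem_iUnion.2 ⟨i, h⟩)
    rcases h with h | h <;> obtain ⟨n, rfl⟩ := mem_range_of_mk_mem_rayEdges h
    · exact he1 k i n
    · exact he2 k i n
  have hinj := Sym2.map.injective (Subtype.val_injective (p := fun v => v ∈ C))
  obtain ⟨P, hP, hPdisj⟩ := exists_twoRays_of_locallyFinite hH fun k =>
    ⟨q k, fun i => ⟨⟨(hq k i).1.1, fun n => ⟨k, i, Or.inl ⟨n, rfl⟩⟩⟩,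
      ⟨(hq k i).2.1.1, fun n => ⟨k, i, Or.inr ⟨n, rfl⟩⟩⟩, (hq k i).2.2⟩,
      fun i j hij => (Set.disjoint_image_iff hinj).1
        ((hdisj k hij).mono (hsub k i) (hsub k j))⟩
  refine ⟨fun i => (Subtype.val ∘ (P i).1, Subtype.val ∘ (P i).2),
    fun i => (hP i).comp Subtype.val_injective hHG, fun i j hij => ?_⟩
  simp only [twoRayEdges_comp]
  exact (Set.disjoint_image_iff hinj).2 (hPdisj hij)
end
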